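/- arXiv:2405.04154 — 3 statements merged into one kernel-verified Lean document; each statement's English description precedes it below -/
import Mathlib

section
/- For any integer g ≥ 2 there exist a B₂[g] sequence A ⊆ ℕ, a constant c > 0 and a threshold x₀ such that |A ∩ [1, x]| ≥ c · x^{g/(2g+1)} for every real x ≥ x₀. -/
noncomputable section

/-- Number of representations of `m` as `b₁ + b₂` with `b₁ ≤ b₂`, `b₁, b₂ ∈ A`. -/
def rA (A : Set ℕ) (m : ℕ) : ℕ :=
  Set.ncard {p : ℕ × ℕ | p.1 ∈ A ∧ p.2 ∈ A ∧ p.1 ≤ p.2 ∧ p.1 + p.2 = m}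

/-- `A` is a `B₂[g]` sequence. -/
def IsB2g (A : Set ℕ) (g : ℕ) : Prop := ∀ m : ℕ, rA A m ≤ g

/-- `|A ∩ [1, x]|`. -/
def countTo (A : Set ℕ) (x : ℝ) : ℕ :=
  Set.ncard {a : ℕ | a ∈ A ∧ 1 ≤ a ∧ (a : ℝ) ≤ x}

/-- The representations of `m` as an ordered sum `b₁ + b₂` with `b₁ ≤ b₂` in the finite set `A`. -/
def repPairs (A : Finset ℕ) (m : ℕ) : Finset (ℕ × ℕ) :=
  {p ∈ A ×ˢ A | p.1 ≤ p.2 ∧ p.1 + p.2 = m}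

/-- The sums of two elements of `A` with at least `s` representations. -/
def popularSums (A : Finset ℕ) (s : ℕ) : Finset ℕ :=
  {m ∈ (A ×ˢ A).image (fun p => p.1 + p.2) | s ≤ (repPairs A m).card}

/-- The number of sums `a + b`, `b ∈ A ∪ {a}`, that have at least `s` representations in `A`. -/
def newPopular (A : Finset ℕ) (s a : ℕ) : ℕ :=
  {b ∈ insert a A | s ≤ (repPairs A (a + b)).card}.card

lemma mem_popularSums {A : Finset ℕ} {s m : ℕ} (hs : 1 ≤ s) :
    m ∈ popularSums A s ↔ s ≤ (repPairs A m).card := by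
  simp only [popularSums, Finset.mem_filter, and_iff_right_iff_imp]
  intro h
  obtain ⟨p, hp⟩ := Finset.card_pos.1 (hs.trans h)
  simp only [repPairs, Finset.mem_filter] at hp
  exact Finset.mem_image.2 ⟨p, hp.1, hp.2.2⟩

lemma rA_coe (A : Finset ℕ) (m : ℕ) : rA (A : Set ℕ) m = (repPairs A m).card := by
  rw [rA, ← Set.ncard_coe_finset]
  congr 1
  ext p
  simp [repPairs, and_assoc]

lemma repPairs_insert_subset (A : Finset ℕ) (a m : ℕ) :
    repPairs (insert a A) m ⊆ insert (min a (m - a), max a (m - a)) (repPairs A m) := by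
  rintro ⟨x, y⟩ h
  simp only [repPairs, Finset.mem_filter, Finset.mem_product, Finset.mem_insert,
    Prod.mk.injEq] at h ⊢
  grind

lemma repPairs_insert_of_notMem {A : Finset ℕ} {a m : ℕ}
    (hm : ∀ b ∈ insert a A, a + b ≠ m) : repPairs (insert a A) m ⊆ repPairs A m := by
  rintro ⟨x, y⟩ h
  simp only [repPairs, Finset.mem_filter, Finset.mem_product, Finset.mem_insert] at h hm ⊢
  grind

lemma card_repPairs_insert_le (A : Finset ℕ) (a m : ℕ) :
    (repPairs (insert a A) m).card ≤ (repPairs A m).card + 1 :=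
  (Finset.card_le_card (repPairs_insert_subset A a m)).trans (Finset.card_insert_le _ _)

lemma card_popularSums_insert_le (A : Finset ℕ) (s a : ℕ) :
    (popularSums (insert a A) (s + 1)).card ≤
      (popularSums A (s + 1)).card + newPopular A s a := by
  have hsub : popularSums (insert a A) (s + 1) ⊆ popularSums A (s + 1) ∪
      ({b ∈ insert a A | s ≤ (repPairs A (a + b)).card}).image (a + ·) := by
    intro m hm
    rw [mem_popularSums (by omega)] at hm
    rw [Finset.mem_union, mem_popularSums (by omega)]
    by_cases h : ∀ b ∈ insert a A, a + b ≠ m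
    · exact Or.inl (hm.trans (Finset.card_le_card (repPairs_insert_of_notMem h)))
    · push Not at h
      obtain ⟨b, hb, rfl⟩ := h
      have := card_repPairs_insert_le A a (a + b)
      exact Or.inr (Finset.mem_image.2 ⟨b, Finset.mem_filter.2 ⟨hb, by omega⟩, rfl⟩)
  exact (Finset.card_le_card hsub).trans
    ((Finset.card_union_le _ _).trans (Nat.add_le_add_left Finset.card_image_le _))

lemma sum_newPopular_le (A I : Finset ℕ) {s : ℕ} (hs : 1 ≤ s) :
    ∑ a ∈ I, newPopular A s a ≤ (A.card + 1) * (popularSums A s).card := by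
  have hpt : ∀ a, newPopular A s a ≤
      (∑ b ∈ A, if a + b ∈ popularSums A s then 1 else 0) +
        if a + a ∈ popularSums A s then 1 else 0 := by
    intro a
    simp only [mem_popularSums hs]
    rw [newPopular, Finset.filter_insert, ← Finset.card_filter]
    split_ifs
    · exact Finset.card_insert_le _ _
    · exact le_rfl
  have hinj : ∀ f : ℕ → ℕ, Function.Injective f →
      (∑ a ∈ I, if f a ∈ popularSums A s then 1 else 0) ≤ (popularSums A s).card := by
    intro f hf
    rw [← Finset.card_filter]
    refine Finset.card_le_card_of_injOn f ?_ hf.injOn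
    intro a ha
    exact (Finset.mem_filter.1 ha).2
  calc ∑ a ∈ I, newPopular A s a
      ≤ ∑ a ∈ I, ((∑ b ∈ A, if a + b ∈ popularSums A s then 1 else 0) +
        if a + a ∈ popularSums A s then 1 else 0) := Finset.sum_le_sum fun a _ => hpt a
    _ ≤ ∑ _b ∈ A, (popularSums A s).card + (popularSums A s).card := by
      rw [Finset.sum_add_distrib, Finset.sum_comm]
      exact add_le_add (Finset.sum_le_sum fun b _ => hinj (· + b) (add_left_injective b))
        (hinj (fun a => a + a) fun x y h => by simp only at h; omega)
    _ = (A.card + 1) * (popularSums A s).card := by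
      rw [Finset.sum_const, smul_eq_mul, add_mul, one_mul]

/-- The invariant of the greedy construction: a finite `B₂[g]` set of size `n ≥ 1` whose elements
are `O(n ^ (2 + 1 / g))` and which has few sums with many representations. -/
structure IsStrongB2g (g : ℕ) (A : Finset ℕ) : Prop where
  card_pos : 1 ≤ A.card
  pos : ∀ a ∈ A, 1 ≤ a
  le : ∀ a ∈ A, (a : ℝ) ≤ (2 * g + 2) * (A.card : ℝ) ^ (2 + 1 / (g : ℝ))
  rep_le : ∀ m, (repPairs A m).card ≤ g
  popular_le : ∀ s < g,
    ((popularSums A (s + 1)).card : ℝ) ≤ (A.card : ℝ) ^ (2 - (s : ℝ) / g)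

lemma isStrongB2g_singleton {g : ℕ} (hg : 1 ≤ g) : IsStrongB2g g {1} where
  card_pos := by simp
  pos := by simp
  le := by simp; linarith [(Nat.cast_nonneg g : (0 : ℝ) ≤ g)]
  rep_le m := by
    refine (Finset.card_filter_le _ _).trans ?_
    simpa using hg
  popular_le s _ := by
    have : (popularSums {1} (s + 1)).card ≤ 1 := by
      refine (Finset.card_filter_le _ _).trans ?_
      simp
    simpa using this

lemma IsStrongB2g.card_bad_le {g : ℕ} {A : Finset ℕ} (hA : IsStrongB2g g A) (I : Finset ℕ)
    {s : ℕ} (hs : s < g) :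
    (({a ∈ I | (A.card : ℝ) ^ (1 - ((s : ℝ) + 1) / g) ≤ newPopular A (s + 1) a}).card : ℝ) ≤
      2 * (A.card : ℝ) ^ (2 + 1 / (g : ℝ)) := by
  set n : ℝ := (A.card : ℝ) with hn
  have hn1 : 1 ≤ n := by rw [hn]; exact_mod_cast hA.card_pos
  have hn0 : 0 < n := by linarith
  set t : ℝ := n ^ (1 - ((s : ℝ) + 1) / g) with ht
  have ht0 : 0 < t := Real.rpow_pos_of_pos hn0 _
  have h1 : (({a ∈ I | t ≤ newPopular A (s + 1) a}).card : ℝ) * t ≤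
      (n + 1) * n ^ (2 - (s : ℝ) / g) := by
    calc (({a ∈ I | t ≤ newPopular A (s + 1) a}).card : ℝ) * t
        = ∑ a ∈ I with t ≤ newPopular A (s + 1) a, t := by
          rw [Finset.sum_const, nsmul_eq_mul]
      _ ≤ ∑ a ∈ I with t ≤ newPopular A (s + 1) a, (newPopular A (s + 1) a : ℝ) :=
          Finset.sum_le_sum fun a ha => (Finset.mem_filter.1 ha).2
      _ ≤ (n + 1) * (popularSums A (s + 1)).card := by
          rw [← Nat.cast_sum, hn]
          exact_mod_cast sum_newPopular_le A _ (Nat.le_add_left 1 s)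
      _ ≤ (n + 1) * n ^ (2 - (s : ℝ) / g) := by
          gcongr
          exact hA.popular_le s hs
  have h2 : (n + 1) * n ^ (2 - (s : ℝ) / g) ≤ 2 * n ^ (2 + 1 / (g : ℝ)) * t := by
    have e : n ^ (2 + 1 / (g : ℝ)) * t = n * n ^ (2 - (s : ℝ) / g) := by
      rw [ht, ← Real.rpow_add hn0, ← Real.rpow_one_add' hn0.le]
      · congr 1; ring
      · have : (s : ℝ) / g ≤ 1 := div_le_one_of_le₀ (by exact_mod_cast hs.le) (by positivity)
        linarith
    rw [mul_assoc, e, ← mul_assoc]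
    gcongr
    linarith
  exact le_of_mul_le_mul_right (h1.trans h2) ht0

lemma IsStrongB2g.exists_new {g : ℕ} {A : Finset ℕ} (hA : IsStrongB2g g A) :
    ∃ a : ℕ, 1 ≤ a ∧ (a : ℝ) ≤ (2 * g + 2) * (A.card : ℝ) ^ (2 + 1 / (g : ℝ)) ∧ a ∉ A ∧
      ∀ s < g, (newPopular A (s + 1) a : ℝ) < (A.card : ℝ) ^ (1 - ((s : ℝ) + 1) / g) := by
  set n : ℝ := (A.card : ℝ) with hn
  have hn1 : 1 ≤ n := by rw [hn]; exact_mod_cast hA.card_pos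
  set T : ℝ := n ^ (2 + 1 / (g : ℝ))
  have hnT : n ≤ T := by
    have : (0 : ℝ) ≤ 1 / g := by positivity
    exact Real.self_le_rpow_of_one_le hn1 (by linarith)
  set N : ℕ := ⌊(2 * g + 1) * T⌋₊ + 1 with hN
  have hN1 : (2 * g + 1) * T < N := by
    rw [hN]; exact_mod_cast Nat.lt_floor_add_one _
  have hN2 : (N : ℝ) ≤ (2 * g + 2) * T := by
    have := Nat.floor_le (show 0 ≤ (2 * (g : ℝ) + 1) * T by positivity)
    rw [hN]; push_cast; linarith
  let bad : ℕ → Finset ℕ := fun s =>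
    (Finset.Icc 1 N).filter fun a => n ^ (1 - ((s : ℝ) + 1) / g) ≤ newPopular A (s + 1) a
  have hcard : (A ∪ (Finset.range g).biUnion bad).card < (Finset.Icc 1 N).card := by
    have h1 : (((Finset.range g).biUnion bad).card : ℝ) ≤ g * (2 * T) := by
      calc (((Finset.range g).biUnion bad).card : ℝ)
          ≤ ∑ s ∈ Finset.range g, ((bad s).card : ℝ) := by exact_mod_cast Finset.card_biUnion_le
        _ ≤ ∑ s ∈ Finset.range g, 2 * T :=
          Finset.sum_le_sum fun s hs => hA.card_bad_le _ (Finset.mem_range.1 hs)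
        _ = g * (2 * T) := by simp
    have h2 : ((A ∪ (Finset.range g).biUnion bad).card : ℝ) ≤
        n + ((Finset.range g).biUnion bad).card := by
      rw [hn]
      exact_mod_cast Finset.card_union_le _ _
    rw [Nat.card_Icc, Nat.add_sub_cancel]
    have h3 : ((A ∪ (Finset.range g).biUnion bad).card : ℝ) < N := by linarith
    exact_mod_cast h3
  obtain ⟨a, haI, ha⟩ := Finset.exists_mem_notMem_of_card_lt_card hcard
  rw [Finset.mem_union, not_or] at ha
  have hI := Finset.mem_Icc.1 haI
  refine ⟨a, hI.1, le_trans (by exact_mod_cast hI.2) hN2, ha.1, fun s hs => ?_⟩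
  by_contra! h
  exact ha.2 (Finset.mem_biUnion.2 ⟨s, Finset.mem_range.2 hs, Finset.mem_filter.2 ⟨haI, h⟩⟩)

lemma IsStrongB2g.exists_insert {g : ℕ} (hg : 1 ≤ g) {A : Finset ℕ} (hA : IsStrongB2g g A) :
    ∃ a ∉ A, IsStrongB2g g (insert a A) := by
  obtain ⟨a, ha1, haT, haA, hnew⟩ := hA.exists_new
  have hc : (insert a A).card = A.card + 1 := Finset.card_insert_of_notMem haA
  have hn1 : (1 : ℝ) ≤ A.card := by exact_mod_cast hA.card_pos
  have hn0 : (0 : ℝ) < A.card := by linarith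
  have hmono : (2 * (g : ℝ) + 2) * (A.card : ℝ) ^ (2 + 1 / (g : ℝ)) ≤
      (2 * g + 2) * ((A.card + 1 : ℕ) : ℝ) ^ (2 + 1 / (g : ℝ)) := by
    gcongr
    simp
  refine ⟨a, haA, by omega, ?_, ?_, ?_, ?_⟩
  · exact Finset.forall_mem_insert _ _ _ |>.2 ⟨ha1, hA.pos⟩
  · rw [hc]
    exact Finset.forall_mem_insert _ _ _ |>.2
      ⟨haT.trans hmono, fun b hb => (hA.le b hb).trans hmono⟩
  · intro m
    by_cases h : ∀ b ∈ insert a A, a + b ≠ m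
    · exact (Finset.card_le_card (repPairs_insert_of_notMem h)).trans (hA.rep_le m)
    · push Not at h
      obtain ⟨b, hb, rfl⟩ := h
      have h0 := hnew (g - 1) (by omega)
      have hgR : ((g - 1 : ℕ) : ℝ) + 1 = g := by exact_mod_cast Nat.sub_add_cancel hg
      rw [hgR, div_self (by positivity), sub_self, Real.rpow_zero, Nat.sub_add_cancel hg] at h0
      have h0' : newPopular A g a = 0 := by
        have : newPopular A g a < 1 := by exact_mod_cast h0
        omega
      have := (Finset.filter_eq_empty_iff.1 (Finset.card_eq_zero.1 h0')) hb
      have := card_repPairs_insert_le A a (a + b)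
      omega
  · intro s hs
    have hstep : ((popularSums (insert a A) (s + 1)).card : ℝ) ≤
        (popularSums A (s + 1)).card + newPopular A s a := by
      exact_mod_cast card_popularSums_insert_le A s a
    have hpop := hA.popular_le s hs
    rw [hc]
    push_cast
    rcases s with _ | s
    · have h0 : (newPopular A 0 a : ℝ) ≤ A.card + 1 := by
        rw [← Nat.cast_add_one, ← hc]
        exact_mod_cast Finset.card_filter_le _ _
      norm_num at hpop hstep ⊢
      nlinarith
    · have h0 := hnew s (by omega)
      push_cast at hpop ⊢
      have hle : ((s : ℝ) + 1) / g ≤ 1 :=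
        div_le_one_of_le₀ (by exact_mod_cast hs.le) (by positivity)
      set e : ℝ := 1 - ((s : ℝ) + 1) / g with he
      have h2 : 2 - ((s : ℝ) + 1) / g = 1 + e := by rw [he]; ring
      rw [h2] at hpop ⊢
      have he0 : 0 ≤ e := by linarith
      rw [Real.rpow_one_add' hn0.le (by positivity)] at hpop
      rw [Real.rpow_one_add' (by positivity) (by positivity)]
      have hm : (A.card : ℝ) ^ e ≤ (A.card + 1 : ℝ) ^ e :=
        Real.rpow_le_rpow hn0.le (by linarith) he0
      nlinarith

lemma exists_chain {g : ℕ} (hg : 1 ≤ g) :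
    ∃ A : ℕ → Finset ℕ, Monotone A ∧ ∀ k, IsStrongB2g g (A k) ∧ (A k).card = k + 1 := by
  choose! f hf hf' using fun (A : Finset ℕ) (hA : IsStrongB2g g A) => hA.exists_insert hg
  refine ⟨fun k => Nat.rec {1} (fun _ A => insert (f A) A) k,
    monotone_nat_of_le_succ fun k => Finset.subset_insert _ _, fun k => ?_⟩
  induction k with
  | zero => exact ⟨isStrongB2g_singleton hg, by simp⟩
  | succ k ih => exact ⟨hf' _ ih.1, by rw [Finset.card_insert_of_notMem (hf _ ih.1), ih.2]⟩

lemma isB2g_iUnion {g : ℕ} {A : ℕ → Finset ℕ} (hmono : Monotone A)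
    (hA : ∀ k, IsStrongB2g g (A k)) : IsB2g (⋃ k, (A k : Set ℕ)) g := by
  intro m
  have hfin : ((⋃ k, (A k : Set ℕ)) ∩ Set.Iic m).Finite := (Set.finite_Iic m).inter_of_right _
  have hdir : Directed (· ⊆ ·) fun k => (A k : Set ℕ) :=
    Monotone.directed_le fun _ _ h => Finset.coe_subset.2 (hmono h)
  obtain ⟨k, hk⟩ := hdir.exists_mem_subset_of_finset_subset_biUnion
    (s := hfin.toFinset) (by simp)
  rw [Set.Finite.coe_toFinset] at hk
  refine le_trans ?_ ((rA_coe (A k) m).trans_le ((hA k).rep_le m))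
  refine Set.ncard_le_ncard ?_ ?_
  · rintro p ⟨h1, h2, h3, h4⟩
    exact ⟨hk ⟨h1, Set.mem_Iic.2 (by omega)⟩, hk ⟨h2, Set.mem_Iic.2 (by omega)⟩, h3, h4⟩
  · refine (A k ×ˢ A k).finite_toSet.subset ?_
    rintro p ⟨h1, h2, -⟩
    exact Finset.mem_coe.2 (Finset.mem_product.2 ⟨h1, h2⟩)

lemma IsStrongB2g.card_le_countTo {g : ℕ} {B : Finset ℕ} (hB : IsStrongB2g g B) {A : Set ℕ}
    (hBA : (B : Set ℕ) ⊆ A) {x : ℝ} (hx : (2 * g + 2) * (B.card : ℝ) ^ (2 + 1 / (g : ℝ)) ≤ x) :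
    B.card ≤ countTo A x := by
  rw [countTo, ← Set.ncard_coe_finset]
  refine Set.ncard_le_ncard (fun a ha => ⟨hBA ha, hB.pos a ha, (hB.le a ha).trans hx⟩) ?_
  refine (Set.finite_Iic ⌊x⌋₊).subset ?_
  rintro a ⟨-, -, ha⟩
  exact Nat.le_floor ha

theorem stmt2 (g : ℕ) (hg : 2 ≤ g) :
    ∃ (A : Set ℕ) (c x₀ : ℝ), 0 < c ∧ IsB2g A g ∧
      ∀ x : ℝ, x₀ ≤ x → c * x ^ ((g : ℝ) / (2 * (g : ℝ) + 1)) ≤ (countTo A x : ℝ) := by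
  obtain ⟨A, hmono, hA⟩ := exists_chain (show 1 ≤ g by omega)
  have hg0 : (0 : ℝ) < g := by exact_mod_cast (by omega : 0 < g)
  set C : ℝ := 2 * g + 2
  set θ : ℝ := (g : ℝ) / (2 * (g : ℝ) + 1) with hθ
  have hC0 : 0 < C := by positivity
  have hθ0 : 0 < θ := by positivity
  refine ⟨⋃ k, (A k : Set ℕ), 1 / 2 * (1 / C) ^ θ, C, by positivity,
    isB2g_iUnion hmono fun k => (hA k).1, fun x hx => ?_⟩
  have hx0 : 0 < x := hC0.trans_le hx
  set y : ℝ := (x / C) ^ θ with hy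
  have hy1 : 1 ≤ y := Real.one_le_rpow ((one_le_div hC0).2 hx) hθ0.le
  obtain ⟨k, hk⟩ : ∃ k, ⌊y⌋₊ = k + 1 :=
    Nat.exists_eq_succ_of_ne_zero (Nat.floor_pos.2 hy1).ne'
  have hky : ((k + 1 : ℕ) : ℝ) ≤ y := hk ▸ Nat.floor_le (by linarith)
  have hyk : y < ((k + 1 : ℕ) : ℝ) + 1 := hk ▸ Nat.lt_floor_add_one y
  have hpow : C * ((k + 1 : ℕ) : ℝ) ^ (2 + 1 / (g : ℝ)) ≤ x := by
    calc C * ((k + 1 : ℕ) : ℝ) ^ (2 + 1 / (g : ℝ)) ≤ C * y ^ (2 + 1 / (g : ℝ)) := by gcongr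
      _ = x := by
        have : θ * (2 + 1 / (g : ℝ)) = 1 := by rw [hθ]; field_simp
        rw [hy, ← Real.rpow_mul (by positivity), this, Real.rpow_one]
        field_simp
  have hcount : ((k + 1 : ℕ) : ℝ) ≤ countTo (⋃ k, (A k : Set ℕ)) x := by
    have := (hA k).1.card_le_countTo (Set.subset_iUnion (fun k => (A k : Set ℕ)) k)
      (x := x) (by rw [(hA k).2]; exact hpow)
    rw [(hA k).2] at this
    exact_mod_cast this
  have hk1 : (1 : ℝ) ≤ ((k + 1 : ℕ) : ℝ) := by exact_mod_cast Nat.le_add_left 1 k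
  calc 1 / 2 * (1 / C) ^ θ * x ^ θ = y / 2 := by
        rw [hy, div_eq_mul_one_div x C, Real.mul_rpow hx0.le (by positivity)]; ring
    _ ≤ ((k + 1 : ℕ) : ℝ) := by linarith
    _ ≤ _ := hcount
end
end

section
/- There exist a B₂[2] sequence A ⊆ ℕ, a constant C > 0 and a threshold N₀ ∈ ℕ such that every integer n ≥ N₀ can be written as n = a₁ + a₂ + a₃ with a₁, a₂, a₃ ∈ A and a₃ ≤ C · n^{1/2} (log n)^{5/2}. -/
noncomputable section

namespace AdditiveBasis

open Finset Classical

/-- Number of unordered representations of `m` as a sum of two elements of `A`. -/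
def rep (A : Finset ℕ) (m : ℕ) : ℕ :=
  #{p ∈ A ×ˢ A | p.1 ≤ p.2 ∧ p.1 + p.2 = m}

/-- `A` is a finite `B₂[2]` set. -/
def Good (A : Finset ℕ) : Prop := ∀ m, rep A m ≤ 2

/-- Adding `f` to `A` might create a third representation of some integer. -/
def Forb (A : Finset ℕ) (f : ℕ) : Prop := ∃ b ∈ insert f A, 2 ≤ rep A (f + b)

/-- The integers having at least two representations. -/
def bad (A : Finset ℕ) : Finset ℕ :=
  {m ∈ (A ×ˢ A).image fun p => p.1 + p.2 | 2 ≤ rep A m}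

/-- Number of representations of `k` as a difference of two elements of `A`. -/
def diffs (A : Finset ℕ) (k : ℕ) : ℕ := #{x ∈ A | x + k ∈ A}

/-- Number of representations `k = b₁ + b₂ - b₃` with `bᵢ ∈ A`. -/
def rho (A : Finset ℕ) (k : ℕ) : ℕ :=
  #{p ∈ A ×ˢ A ×ˢ A | p.1 + p.2.1 = k + p.2.2}

/-- Number of elements of `P` that are forbidden for `A`. -/
def forbCount (A P : Finset ℕ) : ℕ := #{f ∈ P | Forb A f}

/-- If `f` becomes forbidden when `a` is added to `A`, then `a` and `f` are in conflict. -/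
def Conf (A : Finset ℕ) (a f : ℕ) : Prop :=
  a + f ∈ bad A ∨
  (∃ a' ∈ A, ∃ b ∈ A, ∃ b₁ ∈ A, ∃ b₂ ∈ A, b₁ + b₂ = a + a' ∧ b₁ + b₂ = f + b) ∨
  (∃ b ∈ A, f + b = a + a) ∨ (∃ b ∈ A, a + b = f + f)

theorem Conf.symm {A : Finset ℕ} {a f : ℕ} (h : Conf A a f) : Conf A f a := by
  rcases h with h | ⟨x, hx, y, hy, z, hz, w, hw, h1, h2⟩ | h | h
  · exact Or.inl (by rwa [add_comm])
  · exact Or.inr (Or.inl ⟨y, hy, x, hx, z, hz, w, hw, h2, h1⟩)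
  · exact Or.inr (Or.inr (Or.inr h))
  · exact Or.inr (Or.inr (Or.inl h))

theorem exists_of_rep_pos {A : Finset ℕ} {m : ℕ} (h : 0 < rep A m) :
    ∃ x ∈ A, ∃ y ∈ A, x + y = m := by
  rw [rep, card_pos] at h
  obtain ⟨p, hp⟩ := h
  simp only [mem_filter, mem_product] at hp
  exact ⟨p.1, hp.1.1, p.2, hp.1.2, hp.2.2⟩

theorem mem_bad {A : Finset ℕ} {m : ℕ} : m ∈ bad A ↔ 2 ≤ rep A m := by
  constructor
  · intro h
    exact (mem_filter.1 h).2
  · intro h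
    obtain ⟨x, hx, y, hy, hxy⟩ := exists_of_rep_pos (show 0 < rep A m by omega)
    exact mem_filter.2 ⟨mem_image.2 ⟨(x, y), by simp [hx, hy], hxy⟩, h⟩

theorem rep_insert_le (A : Finset ℕ) (a m : ℕ) : rep (insert a A) m ≤ rep A m + 1 := by
  have hsub : ({p ∈ insert a A ×ˢ insert a A | p.1 ≤ p.2 ∧ p.1 + p.2 = m} : Finset (ℕ × ℕ)) ⊆
      {p ∈ A ×ˢ A | p.1 ≤ p.2 ∧ p.1 + p.2 = m} ∪ {(min a (m - a), max a (m - a))} := by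
    rintro ⟨x, y⟩ h
    simp only [mem_filter, mem_product, mem_insert, mem_union, mem_singleton, Prod.mk.injEq] at h ⊢
    by_cases hx : x = a
    · right; omega
    by_cases hy : y = a
    · right; omega
    left
    simp_all
  calc _ ≤ _ := card_le_card hsub
    _ ≤ _ := (card_union_le _ _)
    _ = _ := by simp [rep]

theorem rep_insert_eq (A : Finset ℕ) {a m : ℕ} (h : ∀ b ∈ insert a A, a + b ≠ m) :
    rep (insert a A) m = rep A m := by
  unfold rep
  congr 1
  ext ⟨x, y⟩
  simp only [mem_filter, mem_product]
  constructor
  · rintro ⟨⟨hx, hy⟩, hxy, hm⟩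
    have hxa : x ≠ a := by rintro rfl; exact h y hy hm
    have hya : y ≠ a := by rintro rfl; exact h x hx (by omega)
    simp_all
  · rintro ⟨⟨hx, hy⟩, hxy⟩
    exact ⟨⟨mem_insert_of_mem hx, mem_insert_of_mem hy⟩, hxy⟩

theorem Good.insert {A : Finset ℕ} (hA : Good A) {a : ℕ} (ha : ¬ Forb A a) :
    Good (insert a A) := by
  intro m
  by_cases h : ∀ b ∈ Insert.insert a A, a + b ≠ m
  · rw [rep_insert_eq A h]; exact hA m
  · push Not at h
    obtain ⟨b, hb, rfl⟩ := h
    have h1 : ¬ 2 ≤ rep A (a + b) := fun h2 => ha ⟨b, hb, h2⟩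
    have := rep_insert_le A a (a + b)
    omega

/-- Number of ordered representations of an integer in a `B₂[2]` set. -/
theorem Good.card_ordered_le {A : Finset ℕ} (hA : Good A) (m : ℕ) :
    #{p ∈ A ×ˢ A | p.1 + p.2 = m} ≤ 4 := by
  have hsub : ({p ∈ A ×ˢ A | p.1 + p.2 = m} : Finset (ℕ × ℕ)) ⊆
      {p ∈ A ×ˢ A | p.1 ≤ p.2 ∧ p.1 + p.2 = m} ∪
      ({p ∈ A ×ˢ A | p.1 ≤ p.2 ∧ p.1 + p.2 = m}).image Prod.swap := by
    rintro ⟨x, y⟩ h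
    simp only [mem_filter, mem_product, mem_union, mem_image, Prod.exists, Prod.swap_prod_mk,
      Prod.mk.injEq] at h ⊢
    rcases le_total x y with hxy | hxy
    · left; tauto
    · right; exact ⟨y, x, ⟨⟨h.1.2, h.1.1⟩, hxy, by omega⟩, rfl, rfl⟩
  have h1 := card_le_card hsub
  have h2 := card_union_le {p ∈ A ×ˢ A | p.1 ≤ p.2 ∧ p.1 + p.2 = m}
    (({p ∈ A ×ˢ A | p.1 ≤ p.2 ∧ p.1 + p.2 = m}).image Prod.swap)
  have h3 : #(({p ∈ A ×ˢ A | p.1 ≤ p.2 ∧ p.1 + p.2 = m}).image Prod.swap) ≤ _ := card_image_le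
  have h4 := hA m
  rw [rep] at h4
  omega

theorem forb_insert {A : Finset ℕ} {a f : ℕ} (h : Forb (insert a A) f) (hf : f ∉ insert a A) :
    Forb A f ∨ Conf A a f := by
  obtain ⟨b, hb, h2⟩ := h
  by_cases hr : 2 ≤ rep A (f + b)
  · rw [mem_insert, mem_insert] at hb
    rcases hb with rfl | rfl | hb
    · exact Or.inl ⟨_, mem_insert_self _ _, hr⟩
    · exact Or.inr (Or.inl (by rw [mem_bad, add_comm]; exact hr))
    · exact Or.inl ⟨b, mem_insert_of_mem hb, hr⟩
  · right; right
    have h1 := rep_insert_le A a (f + b)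
    have hne : ¬ ∀ c ∈ insert a A, a + c ≠ f + b := fun hc => by
      rw [rep_insert_eq A hc] at h2; omega
    push Not at hne
    obtain ⟨c, hc, hcm⟩ := hne
    obtain ⟨x, hx, y, hy, hxy⟩ := exists_of_rep_pos (show 0 < rep A (f + b) by omega)
    rw [mem_insert, mem_insert] at hb
    rw [mem_insert, not_or] at hf
    rw [mem_insert] at hc
    rcases hb with rfl | rfl | hb
    · rcases hc with rfl | hc
      · omega
      · exact Or.inr (Or.inr ⟨c, hc, hcm⟩)
    · rcases hc with rfl | hc
      · omega
      · have : c = f := by omega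
        exact absurd (this ▸ hc) hf.2
    · rcases hc with rfl | hc
      · exact Or.inr (Or.inl ⟨b, hb, hcm.symm⟩)
      · exact Or.inl ⟨c, hc, b, hb, x, hx, y, hy, by omega, hxy⟩

theorem card_conf_le (A P : Finset ℕ) (a : ℕ) :
    #{f ∈ P | Conf A a f} ≤ #(bad A) + rho A a * #A + 2 * #A := by
  have hsub : ({f ∈ P | Conf A a f} : Finset ℕ) ⊆
      (((bad A).image fun m => m - a) ∪
      (({p ∈ A ×ˢ A ×ˢ A | p.1 + p.2.1 = a + p.2.2}) ×ˢ A).image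
        (fun q => q.1.1 + q.1.2.1 - q.2)) ∪
      ((A.image fun b => a + a - b) ∪ (A.image fun b => (a + b) / 2)) := by
    intro f hf
    rw [mem_filter] at hf
    rcases hf.2 with h | ⟨x, hx, y, hy, z, hz, w, hw, h1, h2⟩ | ⟨b, hb, h⟩ | ⟨b, hb, h⟩
    · exact mem_union_left _ (mem_union_left _ (mem_image.2 ⟨_, h, by omega⟩))
    · refine mem_union_left _ (mem_union_right _ (mem_image.2 ⟨((z, w, x), y), ?_, ?_⟩))
      · simp [hx, hy, hz, hw, h1]
      · simp only; omega
    · exact mem_union_right _ (mem_union_left _ (mem_image.2 ⟨b, hb, by omega⟩))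
    · exact mem_union_right _ (mem_union_right _ (mem_image.2 ⟨b, hb, by omega⟩))
  refine (card_le_card hsub).trans ?_
  refine (card_union_le _ _).trans ?_
  refine (add_le_add (card_union_le _ _) (card_union_le _ _)).trans ?_
  refine (add_le_add (add_le_add card_image_le card_image_le)
    (add_le_add card_image_le card_image_le)).trans ?_
  rw [card_product, rho]
  omega

theorem card_forb_le (A P : Finset ℕ) : forbCount A P ≤ #(bad A) * #A + #(bad A) := by
  have hsub : ({f ∈ P | Forb A f} : Finset ℕ) ⊆
      (((bad A) ×ˢ A).image fun q => q.1 - q.2) ∪ ((bad A).image fun m => m / 2) := by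
    intro f hf
    obtain ⟨b, hb, h⟩ := (mem_filter.1 hf).2
    rw [mem_insert] at hb
    rcases hb with rfl | hb
    · exact mem_union_right _ (mem_image.2 ⟨_, mem_bad.2 h, by omega⟩)
    · exact mem_union_left _ (mem_image.2 ⟨(f + b, b), by simp [mem_bad.2 h, hb], by simp⟩)
  refine (card_le_card hsub).trans ((card_union_le _ _).trans ?_)
  refine (add_le_add card_image_le card_image_le).trans ?_
  rw [card_product]

theorem card_bad_insert_le (A : Finset ℕ) (a : ℕ) :
    #(bad (insert a A)) ≤ #(bad A) + rho A a + 1 := by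
  have hsub : bad (insert a A) ⊆ (bad A ∪
      ({p ∈ A ×ˢ A ×ˢ A | p.1 + p.2.1 = a + p.2.2}).image (fun p => p.1 + p.2.1)) ∪ {a + a} := by
    intro m hm
    rw [mem_bad] at hm
    by_cases h : 2 ≤ rep A m
    · exact mem_union_left _ (mem_union_left _ (mem_bad.2 h))
    have h1 := rep_insert_le A a m
    have hne : ¬ ∀ c ∈ insert a A, a + c ≠ m := fun hc => by
      rw [rep_insert_eq A hc] at hm; omega
    push Not at hne
    obtain ⟨c, hc, hcm⟩ := hne
    obtain ⟨x, hx, y, hy, hxy⟩ := exists_of_rep_pos (show 0 < rep A m by omega)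
    rw [mem_insert] at hc
    rcases hc with rfl | hc
    · exact mem_union_right _ (by simp [hcm])
    · refine mem_union_left _ (mem_union_right _ (mem_image.2 ⟨(x, y, c), ?_, hxy⟩))
      simp only [mem_filter, mem_product]
      exact ⟨⟨hx, hy, hc⟩, by omega⟩
  refine (card_le_card hsub).trans ((card_union_le _ _).trans ?_)
  refine (add_le_add ((card_union_le _ _).trans (add_le_add le_rfl card_image_le)) le_rfl).trans ?_
  rw [card_singleton, rho]

theorem diffs_insert_le (A : Finset ℕ) (a : ℕ) {k : ℕ} (hk : 0 < k) :
    diffs (insert a A) k ≤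
      diffs A k + ((if a + k ∈ A then 1 else 0) + if k ≤ a ∧ a - k ∈ A then 1 else 0) := by
  have hsub : ({x ∈ insert a A | x + k ∈ insert a A} : Finset ℕ) ⊆
      ({x ∈ A | x + k ∈ A} ∪ (if a + k ∈ A then {a} else ∅)) ∪
        (if k ≤ a ∧ a - k ∈ A then {a - k} else ∅) := by
    intro x hx
    simp only [mem_filter, mem_insert] at hx
    simp only [mem_union, mem_filter]
    obtain ⟨rfl | hx, h | h⟩ := hx
    · omega
    · simp [h]
    · right
      have h1 : a - k = x := by omega
      rw [if_pos ⟨by omega, h1 ▸ hx⟩]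
      simp [h1]
    · tauto
  refine (card_le_card hsub).trans ((card_union_le _ _).trans ?_)
  refine (add_le_add (card_union_le _ _) le_rfl).trans ?_
  rw [diffs]
  split_ifs <;> simp

theorem rho_insert_le (A : Finset ℕ) (a : ℕ) {k : ℕ} (hk : k ∉ insert a A) :
    rho (insert a A) k ≤ rho A k + (2 * #{p ∈ A ×ˢ A | a + p.1 = k + p.2} +
      #{p ∈ A ×ˢ A | p.1 + p.2 = k + a} + #{x ∈ A | a + a = k + x}) := by
  rw [mem_insert, not_or] at hk
  have hsub : ({p ∈ insert a A ×ˢ insert a A ×ˢ insert a A | p.1 + p.2.1 = k + p.2.2} :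
      Finset (ℕ × ℕ × ℕ)) ⊆
      ({p ∈ A ×ˢ A ×ˢ A | p.1 + p.2.1 = k + p.2.2} ∪
      (({p ∈ A ×ˢ A | a + p.1 = k + p.2}).image (fun p => (a, p.1, p.2)) ∪
      ({p ∈ A ×ˢ A | a + p.1 = k + p.2}).image (fun p => (p.1, a, p.2)))) ∪
      (({p ∈ A ×ˢ A | p.1 + p.2 = k + a}).image (fun p => (p.1, p.2, a)) ∪
      ({x ∈ A | a + a = k + x}).image (fun x => (a, a, x))) := by
    rintro ⟨x, y, z⟩ h
    simp only [mem_filter, mem_product, mem_insert] at h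
    simp only [mem_union, mem_filter, mem_product, mem_image, Prod.exists, Prod.mk.injEq]
    obtain ⟨⟨rfl | hx, rfl | hy, rfl | hz⟩, h⟩ := h
    · omega
    · right; right; exact ⟨z, ⟨hz, h⟩, rfl, rfl, rfl⟩
    · have : y = k := by omega
      exact absurd (this ▸ hy) hk.2
    · left; right; left; exact ⟨y, z, ⟨⟨hy, hz⟩, h⟩, rfl, rfl, rfl⟩
    · have : x = k := by omega
      exact absurd (this ▸ hx) hk.2
    · left; right; right; exact ⟨x, z, ⟨⟨hx, hz⟩, by omega⟩, rfl, rfl, rfl⟩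
    · right; left; exact ⟨x, y, ⟨⟨hx, hy⟩, h⟩, rfl, rfl, rfl⟩
    · left; left; exact ⟨⟨hx, hy, hz⟩, h⟩
  refine (card_le_card hsub).trans ((card_union_le _ _).trans ?_)
  refine (add_le_add ((card_union_le _ _).trans (add_le_add le_rfl (card_union_le _ _)))
    (card_union_le _ _)).trans ?_
  refine (add_le_add (add_le_add le_rfl (add_le_add card_image_le card_image_le))
    (add_le_add card_image_le card_image_le)).trans ?_
  rw [rho]
  omega

theorem card_sub_le_diffs (A : Finset ℕ) {a k d : ℕ} (hak : a ≠ k)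
    (hd : ∀ l, 0 < l → diffs A l ≤ d) : #{p ∈ A ×ˢ A | a + p.1 = k + p.2} ≤ d := by
  rcases lt_or_gt_of_ne hak with h | h
  · refine le_trans ?_ (hd (k - a) (by omega))
    refine card_le_card_of_injOn Prod.snd ?_ ?_
    · rintro ⟨x, y⟩ hp
      simp only [mem_coe, mem_filter, mem_product] at hp ⊢
      have : y + (k - a) = x := by omega
      exact ⟨hp.1.2, this ▸ hp.1.1⟩
    · rintro ⟨x, y⟩ hp ⟨x', y'⟩ hp' hh
      simp only [mem_coe, mem_filter, mem_product, Prod.mk.injEq] at hp hp' hh ⊢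
      omega
  · refine le_trans ?_ (hd (a - k) (by omega))
    refine card_le_card_of_injOn Prod.fst ?_ ?_
    · rintro ⟨x, y⟩ hp
      simp only [mem_coe, mem_filter, mem_product] at hp ⊢
      have : x + (a - k) = y := by omega
      exact ⟨hp.1.1, this ▸ hp.1.2⟩
    · rintro ⟨x, y⟩ hp ⟨x', y'⟩ hp' hh
      simp only [mem_coe, mem_filter, mem_product, Prod.mk.injEq] at hp hp' hh ⊢
      omega

/-- Double counting: a relation determining `a` from the index has few pairs. -/
theorem sum_card_filter_le {ι : Type*} (G : Finset ℕ) (Q : Finset ι) (r : ℕ → ι → Prop)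
    (h : ∀ q ∈ Q, ∀ a ∈ G, ∀ a' ∈ G, r a q → r a' q → a = a') :
    ∑ a ∈ G, #{q ∈ Q | r a q} ≤ #Q := by
  have h1 := sum_card_bipartiteAbove_eq_sum_card_bipartiteBelow (s := G) (t := Q) r
  simp only [bipartiteAbove, bipartiteBelow] at h1
  rw [h1, card_eq_sum_ones]
  refine sum_le_sum fun q hq => card_le_one.2 ?_
  intro a ha b hb
  rw [mem_filter] at ha hb
  exact h q hq a ha.1 b hb.1 ha.2 hb.2

theorem sum_diffs_increment_le (A G : Finset ℕ) (k : ℕ) :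
    ∑ a ∈ G, ((if a + k ∈ A then 1 else 0) + if k ≤ a ∧ a - k ∈ A then 1 else 0) ≤ 2 * #A := by
  rw [sum_add_distrib, ← card_filter, ← card_filter, two_mul]
  refine add_le_add ?_ ?_
  · refine card_le_card_of_injOn (fun a => a + k) ?_ ?_
    · intro a ha
      exact (mem_filter.1 ha).2
    · intro a _ b _ h
      simpa using h
  · refine card_le_card_of_injOn (fun a => a - k) ?_ ?_
    · intro a ha
      exact (mem_filter.1 ha).2.2
    · intro a ha b hb h
      simp only [mem_coe, mem_filter] at ha hb h
      omega

theorem sum_rho_increment_le (A G : Finset ℕ) (k : ℕ) :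
    ∑ a ∈ G, (2 * #{p ∈ A ×ˢ A | a + p.1 = k + p.2} +
      #{p ∈ A ×ˢ A | p.1 + p.2 = k + a} + #{x ∈ A | a + a = k + x}) ≤ 4 * #A ^ 2 := by
  rw [sum_add_distrib, sum_add_distrib, ← mul_sum]
  have h1 := sum_card_filter_le G (A ×ˢ A) (fun a p => a + p.1 = k + p.2)
    (fun q _ a _ b _ h h' => by omega)
  have h2 := sum_card_filter_le G (A ×ˢ A) (fun a p => p.1 + p.2 = k + a)
    (fun q _ a _ b _ h h' => by omega)
  have h3 := sum_card_filter_le G A (fun a x => a + a = k + x)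
    (fun q _ a _ b _ h h' => by omega)
  rw [card_product] at h1 h2
  have h4 : #A ≤ #A ^ 2 := Nat.le_self_pow two_ne_zero _
  nlinarith

theorem sum_conf_le {A : Finset ℕ} (G P : Finset ℕ) {r : ℕ} (hr : ∀ k, k ∉ A → rho A k ≤ r)
    (hP : Disjoint P A) :
    ∑ a ∈ G, #{f ∈ P | Conf A a f} ≤ #P * (#(bad A) + r * #A + 2 * #A) := by
  have h1 := sum_card_bipartiteAbove_eq_sum_card_bipartiteBelow (s := G) (t := P) (Conf A)
  simp only [bipartiteAbove, bipartiteBelow] at h1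
  rw [h1, ← smul_eq_mul]
  refine sum_le_card_nsmul _ _ _ fun f hf => ?_
  have h2 : #{a ∈ G | Conf A a f} ≤ #{a ∈ G | Conf A f a} :=
    card_le_card fun a ha => mem_filter.2 ⟨(mem_filter.1 ha).1, (mem_filter.1 ha).2.symm⟩
  refine h2.trans ((card_conf_le A G f).trans ?_)
  have := hr f (disjoint_left.1 hP hf)
  gcongr

theorem forbCount_insert_le {A P : Finset ℕ} {a : ℕ} (hP : Disjoint P (insert a A)) :
    forbCount (insert a A) P ≤ forbCount A P + #{f ∈ P | Conf A a f} := by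
  refine le_trans (card_le_card ?_) (card_union_le _ _)
  intro f hf
  rw [mem_filter] at hf
  rw [mem_union, mem_filter, mem_filter]
  rcases forb_insert hf.2 (disjoint_left.1 hP hf.1) with h | h
  · exact Or.inl ⟨hf.1, h⟩
  · exact Or.inr ⟨hf.1, h⟩

/-- The elements of `[1, N]` that may be added to `A`. -/
def free (N : ℕ) (A : Finset ℕ) : Finset ℕ := {a ∈ Icc 1 N | a ∉ A ∧ ¬ Forb A a}

/-- Size and pseudorandomness bounds for a finite `B₂[2]` set. -/
structure Controlled (N c b d r : ℕ) (A : Finset ℕ) : Prop where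
  sub : A ⊆ Icc 1 N
  good : Good A
  card_le : #A ≤ c
  bad_le : #(bad A) ≤ b
  diffs_le : ∀ k, 0 < k → diffs A k ≤ d
  rho_le : ∀ k, k ∉ A → rho A k ≤ r

theorem card_free_ge {N : ℕ} (A : Finset ℕ) :
    N ≤ #(free N A) + (#A + (#(bad A) * #A + #(bad A))) := by
  have hsub : Icc 1 N ⊆ free N A ∪ (A ∪ {f ∈ Icc 1 N | Forb A f}) := by
    intro a ha
    simp only [free, mem_union, mem_filter]
    tauto
  have h1 := card_le_card hsub
  have h2 := card_forb_le A (Icc 1 N)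
  have h3 := card_union_le (free N A) (A ∪ {f ∈ Icc 1 N | Forb A f})
  have h4 := card_union_le A {f ∈ Icc 1 N | Forb A f}
  rw [Nat.card_Icc] at h1
  rw [forbCount] at h2
  omega

theorem sum_exp_le {G : Finset ℕ} {g : ℕ → ℝ} {R M c : ℝ} (hR : 0 < R)
    (h0 : ∀ a ∈ G, 0 ≤ g a) (h1 : ∀ a ∈ G, g a ≤ R) (hM : ∑ a ∈ G, g a ≤ M)
    (hc : 2 * M / R ≤ #G * c) :
    ∑ a ∈ G, Real.exp (g a / R) ≤ #G * Real.exp c := by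
  have key : ∀ a ∈ G, Real.exp (g a / R) ≤ 1 + 2 * (g a / R) := by
    intro a ha
    have hx0 : 0 ≤ g a / R := div_nonneg (h0 a ha) hR.le
    have hx1 : g a / R ≤ 1 := (div_le_one hR).2 (h1 a ha)
    have := Real.abs_exp_sub_one_le (x := g a / R) (by rw [abs_of_nonneg hx0]; exact hx1)
    rw [abs_of_nonneg hx0] at this
    have := le_abs_self (Real.exp (g a / R) - 1)
    linarith
  calc ∑ a ∈ G, Real.exp (g a / R) ≤ ∑ a ∈ G, (1 + 2 * (g a / R)) := sum_le_sum key
    _ = #G + 2 * (∑ a ∈ G, g a) / R := by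
      rw [sum_add_distrib, ← mul_sum, ← sum_div]; simp [mul_div_assoc]
    _ ≤ #G + 2 * M / R := by gcongr
    _ ≤ #G + #G * c := by linarith
    _ = #G * (c + 1) := by ring
    _ ≤ #G * Real.exp c := by gcongr; exact Real.add_one_le_exp c

/-- Exponential potential of a statistic `X` with drift `δ`, counted while `alive` holds. -/
def pot (X : Finset ℕ → ℕ) (alive : Finset ℕ → Prop) (R δ : ℝ) (A₀ : Finset ℕ) (t : ℕ)
    (A : Finset ℕ) : ℝ :=
  if alive A then Real.exp (((X A : ℝ) - X A₀) / R - t * δ) else 0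

theorem pot_nonneg (X : Finset ℕ → ℕ) (alive : Finset ℕ → Prop) (R δ : ℝ) (A₀ : Finset ℕ) (t : ℕ)
    (A : Finset ℕ) : 0 ≤ pot X alive R δ A₀ t A := by
  unfold pot; split_ifs <;> positivity

theorem pot_zero_le (X : Finset ℕ → ℕ) (alive : Finset ℕ → Prop) (R δ : ℝ) (A₀ : Finset ℕ) :
    pot X alive R δ A₀ 0 A₀ ≤ 1 := by
  unfold pot; split_ifs <;> simp

theorem le_of_pot_le {X : Finset ℕ → ℕ} {alive : Finset ℕ → Prop} {R δ L : ℝ} {A₀ : Finset ℕ}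
    {t : ℕ} {A : Finset ℕ} (hR : 0 < R) (h : pot X alive R δ A₀ t A ≤ Real.exp L)
    (hA : alive A) : (X A : ℝ) ≤ X A₀ + R * (L + t * δ) := by
  rw [pot, if_pos hA, Real.exp_le_exp] at h
  have h1 : ((X A : ℝ) - X A₀) / R ≤ L + t * δ := by linarith
  rw [div_le_iff₀ hR] at h1
  linarith

theorem sum_pot_le {X : Finset ℕ → ℕ} {alive : Finset ℕ → Prop} {R δ M : ℝ} {A₀ A G : Finset ℕ}
    {t : ℕ} {g : ℕ → ℕ} (hR : 0 < R) (halive : ∀ a, alive (insert a A) → alive A)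
    (hX : alive A → ∀ a ∈ G, alive (insert a A) → X (insert a A) ≤ X A + g a)
    (hg : alive A → ∀ a ∈ G, alive (insert a A) → (g a : ℝ) ≤ R)
    (hM : alive A → ((∑ a ∈ G, g a : ℕ) : ℝ) ≤ M)
    (hδ : 2 * M / R ≤ #G * δ) :
    ∑ a ∈ G, pot X alive R δ A₀ (t + 1) (insert a A) ≤ #G * pot X alive R δ A₀ t A := by
  by_cases hA : alive A
  · set E := Real.exp (((X A : ℝ) - X A₀) / R - t * δ - δ) with hE
    set g' : ℕ → ℕ := fun a => if alive (insert a A) then g a else 0 with hg'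
    have hgg' : ∀ a ∈ G, g' a ≤ g a := by
      intro a _
      rw [hg']
      dsimp only
      split_ifs <;> simp
    have h1 : ∀ a ∈ G, pot X alive R δ A₀ (t + 1) (insert a A) ≤ E * Real.exp (g' a / R) := by
      intro a ha
      unfold pot
      split_ifs with h
      · rw [hE, ← Real.exp_add, Real.exp_le_exp]
        have h2 : (X (insert a A) : ℝ) ≤ X A + g' a := by
          rw [hg']
          dsimp only
          rw [if_pos h]
          exact_mod_cast hX hA a ha h
        have h3 : ((X (insert a A) : ℝ) - X A₀) / R ≤ ((X A : ℝ) - X A₀) / R + g' a / R := by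
          rw [← add_div]; gcongr; linarith
        push_cast
        linarith
      · positivity
    refine (sum_le_sum h1).trans ?_
    rw [← mul_sum]
    have hR' : ∀ a ∈ G, (g' a : ℝ) ≤ R := by
      intro a ha
      rw [hg']
      dsimp only
      split_ifs with h
      · exact hg hA a ha h
      · simpa using hR.le
    have hM' : ∑ a ∈ G, (g' a : ℝ) ≤ M :=
      le_trans (by exact_mod_cast sum_le_sum hgg') (hM hA)
    have h2 := sum_exp_le (g := fun a => (g' a : ℝ)) (c := δ) hR
      (fun a _ => by positivity) hR' hM' hδ
    calc _ ≤ E * (#G * Real.exp δ) := by gcongr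
      _ = #G * (E * Real.exp δ) := by ring
      _ = _ := by rw [hE, ← Real.exp_add, pot, if_pos hA]; congr 2; ring
  · have h1 : ∀ a ∈ G, pot X alive R δ A₀ (t + 1) (insert a A) ≤ 0 := by
      intro a ha
      rw [pot, if_neg fun h => hA (halive a h)]
    rw [pot, if_neg hA, mul_zero]
    exact sum_nonpos h1

theorem disjoint_of_insert {P A : Finset ℕ} (a : ℕ) (h : Disjoint P (insert a A)) :
    Disjoint P A := h.mono_right (subset_insert a A)

theorem sum_pot_cover_le {N : ℕ} {A₀ A P : Finset ℕ} {t : ℕ} (hN : 0 < N) (hPN : P ⊆ Icc 1 N)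
    (hW : Disjoint P A → 2 * forbCount A P ≤ #P) :
    ∑ a ∈ free N A, pot (fun _ => 0) (Disjoint P) 1 (-(#P / (2 * N))) A₀ (t + 1) (insert a A) ≤
      #(free N A) * pot (fun _ => 0) (Disjoint P) 1 (-(#P / (2 * N))) A₀ t A := by
  by_cases hA : Disjoint P A
  · set δ : ℝ := #P / (2 * N) with hδ
    have h1 : ∀ a ∈ free N A, pot (fun _ => 0) (Disjoint P) 1 (-δ) A₀ (t + 1) (insert a A) ≤
        if a ∉ P then Real.exp (t * δ + δ) else 0 := by
      intro a ha
      unfold pot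
      by_cases h : a ∈ P
      · rw [if_neg, if_neg (by simpa using h)]
        exact fun hd => disjoint_left.1 hd h (mem_insert_self _ _)
      · rw [if_pos h]
        split_ifs
        · rw [Real.exp_le_exp]; push_cast; simp; linarith
        · positivity
    refine (sum_le_sum h1).trans ?_
    rw [← sum_filter, sum_const, nsmul_eq_mul, pot, if_pos hA]
    have hsub : P ⊆ {a ∈ free N A | a ∈ P} ∪ {f ∈ P | Forb A f} := by
      intro f hf
      have := disjoint_left.1 hA hf
      have := hPN hf
      simp only [mem_union, mem_filter, free]
      tauto
    have h2 := (card_le_card hsub).trans (card_union_le _ _)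
    have h3 := hW hA
    have h4 : #{a ∈ free N A | a ∈ P} + #{a ∈ free N A | a ∉ P} = #(free N A) :=
      card_filter_add_card_filter_not _
    rw [forbCount] at h3
    have h5 : #P + 2 * #{a ∈ free N A | a ∉ P} ≤ 2 * #(free N A) := by omega
    have h6 : (#P : ℝ) + 2 * #{a ∈ free N A | a ∉ P} ≤ 2 * #(free N A) := by exact_mod_cast h5
    have h7 : (#(free N A) : ℝ) ≤ N := by
      have : #(free N A) ≤ #(Icc 1 N) := card_le_card (filter_subset _ _)
      rw [Nat.card_Icc] at this
      exact_mod_cast (by omega : #(free N A) ≤ N)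
    have hN' : (0 : ℝ) < N := by exact_mod_cast hN
    have h8 : (#{a ∈ free N A | a ∉ P} : ℝ) ≤ #(free N A) * (1 - δ) := by
      have : #(free N A) * δ ≤ #P / 2 := by
        rw [hδ, mul_div_assoc', div_le_div_iff₀ (by positivity) (by norm_num)]
        have := mul_le_mul_of_nonneg_right h7 (Nat.cast_nonneg (α := ℝ) #P)
        linarith
      linarith
    have h9 : 1 - δ ≤ Real.exp (-δ) := by
      have := Real.add_one_le_exp (-δ); linarith
    calc _ ≤ #(free N A) * (1 - δ) * Real.exp (t * δ + δ) := by gcongr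
      _ ≤ #(free N A) * Real.exp (-δ) * Real.exp (t * δ + δ) := by gcongr
      _ = _ := by rw [mul_assoc, ← Real.exp_add]; congr 2; simp
  · have h1 : ∀ a ∈ free N A, pot (fun _ => 0) (Disjoint P) 1 (-(#P / (2 * N) : ℝ)) A₀ (t + 1)
        (insert a A) ≤ 0 := by
      intro a ha
      rw [pot, if_neg fun h => hA (disjoint_of_insert a h)]
    rw [pot, if_neg hA, mul_zero]
    exact sum_nonpos h1

/-- The right end of the range used in stage `j`. -/
def scale (j : ℕ) : ℕ := 1024 * 32 ^ j

theorem scale_pos (j : ℕ) : 0 < scale j := by unfold scale; positivity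

theorem scale_succ (j : ℕ) : scale (j + 1) = 32 * scale j := by unfold scale; ring

/-- The invariant satisfied after stage `j`. -/
abbrev StageControlled (j : ℕ) (A : Finset ℕ) : Prop :=
  Controlled (scale j) (2 * 4 ^ j) (4 * 8 ^ j) (11 * j ^ 2) (2 ^ j) A

/-- The total potential used in stage `j`. -/
def stagePot (j : ℕ) (A₀ K C : Finset ℕ) (P : ℕ → Finset ℕ) (t : ℕ) (A : Finset ℕ) : ℝ :=
  ∑ k ∈ Icc 1 (scale j),
    pot (fun A => diffs A k) (fun _ => True) 2 (8 * 4 ^ j / scale j) A₀ t A +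
  ∑ k ∈ range (2 * scale j),
    pot (fun A => rho A k) (fun A => k ∉ A) (22 * j ^ 2 + 5)
      (64 * 16 ^ j / ((22 * j ^ 2 + 5) * scale j)) A₀ t A +
  ∑ i ∈ K, pot (fun A => forbCount A (P i)) (Disjoint (P i)) (10 * 8 ^ j)
    (4 * #(P i) / scale j) A₀ t A +
  ∑ i ∈ C, pot (fun _ => 0) (Disjoint (P i)) 1 (-(#(P i) / (2 * scale j))) A₀ t A

theorem scale_le_two_mul_card_free {j : ℕ} {A : Finset ℕ} (hA : StageControlled j A) :
    scale j ≤ 2 * #(free (scale j) A) := by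
  have h1 := card_free_ge (N := scale j) A
  have h2 : #(bad A) * #A ≤ 4 * 8 ^ j * (2 * 4 ^ j) := Nat.mul_le_mul hA.bad_le hA.card_le
  have h3 : 4 * 8 ^ j * (2 * 4 ^ j) = 8 * 32 ^ j := by
    rw [show (32 : ℕ) = 8 * 4 by norm_num, mul_pow]; ring
  have h4 : 8 ^ j ≤ 32 ^ j := Nat.pow_le_pow_left (by norm_num) j
  have h5 : 4 ^ j ≤ 32 ^ j := Nat.pow_le_pow_left (by norm_num) j
  have h6 := hA.bad_le
  have h7 := hA.card_le
  have h8 : scale j = 1024 * 32 ^ j := rfl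
  omega

theorem sum_stagePot_le {j : ℕ} {A₀ A K C : Finset ℕ} {P : ℕ → Finset ℕ} {t : ℕ}
    (hA : StageControlled j A) (hCP : ∀ i ∈ C, P i ⊆ Icc 1 (scale j))
    (hCW : ∀ i ∈ C, Disjoint (P i) A → 2 * forbCount A (P i) ≤ #(P i)) :
    ∑ a ∈ free (scale j) A, stagePot j A₀ K C P (t + 1) (insert a A) ≤
      #(free (scale j) A) * stagePot j A₀ K C P t A := by
  have hN : (0 : ℝ) < scale j := by exact_mod_cast scale_pos j
  have hG : (scale j : ℝ) / 2 ≤ #(free (scale j) A) := by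
    have : (scale j : ℝ) ≤ 2 * #(free (scale j) A) := by
      exact_mod_cast scale_le_two_mul_card_free hA
    linarith
  have hc : #A ≤ 2 * 4 ^ j := hA.card_le
  unfold stagePot
  simp only [mul_add, mul_sum]
  rw [sum_add_distrib, sum_add_distrib, sum_add_distrib]
  refine add_le_add (add_le_add (add_le_add ?_ ?_) ?_) ?_
  · rw [sum_comm]
    refine sum_le_sum fun k hk => ?_
    have hk0 : 0 < k := (mem_Icc.1 hk).1
    refine sum_pot_le (M := 4 * 4 ^ j)
      (g := fun a => (if a + k ∈ A then 1 else 0) + if k ≤ a ∧ a - k ∈ A then 1 else 0)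
      (by norm_num) (fun _ _ => trivial) (fun _ a _ _ => diffs_insert_le A a hk0) ?_ ?_ ?_
    · intro _ a _ _
      split_ifs <;> norm_num
    · intro _
      have h1 := sum_diffs_increment_le A (free (scale j) A) k
      exact_mod_cast (by omega : _ ≤ 4 * 4 ^ j)
    · calc (2 * (4 * 4 ^ j) / 2 : ℝ) = scale j / 2 * (8 * 4 ^ j / scale j) := by
            field_simp; ring
        _ ≤ _ := by gcongr
  · rw [sum_comm]
    refine sum_le_sum fun k hk => ?_
    refine sum_pot_le (M := 16 * 16 ^ j)
      (g := fun a => 2 * #{p ∈ A ×ˢ A | a + p.1 = k + p.2} +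
        #{p ∈ A ×ˢ A | p.1 + p.2 = k + a} + #{x ∈ A | a + a = k + x})
      (by positivity) ?_ ?_ ?_ ?_ ?_
    · intro a h h'
      exact h (mem_insert_of_mem h')
    · intro _ a _ h
      exact rho_insert_le A a h
    · intro _ a _ hka
      have hak : a ≠ k := fun h => hka (h ▸ mem_insert_self a A)
      have h1 := card_sub_le_diffs A hak hA.diffs_le
      have h2 := hA.good.card_ordered_le (k + a)
      have h3 : #{x ∈ A | a + a = k + x} ≤ 1 := by
        refine card_le_one.2 ?_
        simp only [mem_filter]
        intro x hx y hy
        omega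
      have h4 : 2 * #{p ∈ A ×ˢ A | a + p.1 = k + p.2} +
        #{p ∈ A ×ˢ A | p.1 + p.2 = k + a} + #{x ∈ A | a + a = k + x} ≤ 22 * j ^ 2 + 5 := by
        omega
      exact_mod_cast h4
    · intro _
      have h1 := sum_rho_increment_le A (free (scale j) A) k
      have h2 : #A ^ 2 ≤ (2 * 4 ^ j) ^ 2 := Nat.pow_le_pow_left hc 2
      have h3 : (2 * 4 ^ j) ^ 2 = 4 * 16 ^ j := by
        rw [show (16 : ℕ) = 4 * 4 by norm_num, mul_pow, mul_pow]; ring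
      exact_mod_cast (by omega : _ ≤ 16 * 16 ^ j)
    · calc (2 * (16 * 16 ^ j) / (22 * j ^ 2 + 5) : ℝ)
          = scale j / 2 * (64 * 16 ^ j / ((22 * j ^ 2 + 5) * scale j)) := by
            field_simp; ring
        _ ≤ _ := by gcongr
  · rw [sum_comm]
    refine sum_le_sum fun i hi => ?_
    have hE : #(bad A) + 2 ^ j * #A + 2 * #A ≤ 10 * 8 ^ j := by
      have h1 : 2 ^ j * #A ≤ 2 ^ j * (2 * 4 ^ j) := Nat.mul_le_mul_left _ hc
      have h2 : 2 ^ j * (2 * 4 ^ j) = 2 * 8 ^ j := by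
        rw [show (8 : ℕ) = 2 * 4 by norm_num, mul_pow]; ring
      have h3 : 4 ^ j ≤ 8 ^ j := Nat.pow_le_pow_left (by norm_num) j
      have := hA.bad_le
      omega
    refine sum_pot_le (M := #(P i) * (10 * 8 ^ j)) (g := fun a => #{f ∈ P i | Conf A a f})
      (by positivity) (fun a => disjoint_of_insert a) ?_ ?_ ?_ ?_
    · intro _ a _ h
      exact forbCount_insert_le h
    · intro _ a ha _
      have h1 := card_conf_le A (P i) a
      have h2 := hA.rho_le a (mem_filter.1 ha).2.1
      have h3 : rho A a * #A ≤ 2 ^ j * #A := Nat.mul_le_mul_right _ h2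
      exact_mod_cast (by omega : #{f ∈ P i | Conf A a f} ≤ 10 * 8 ^ j)
    · intro h
      have h1 := sum_conf_le (free (scale j) A) (P i) hA.rho_le h
      have h2 := Nat.mul_le_mul_left #(P i) hE
      exact_mod_cast h1.trans h2
    · calc (2 * (#(P i) * (10 * 8 ^ j)) / (10 * 8 ^ j) : ℝ)
          = scale j / 2 * (4 * #(P i) / scale j) := by
            field_simp; ring
        _ ≤ _ := by gcongr
  · rw [sum_comm]
    exact sum_le_sum fun i hi => sum_pot_cover_le (scale_pos j) (hCP i hi) (hCW i hi)

theorem cubic_le_two_pow {j : ℕ} (hj : 30 ≤ j) : 16 * ((22 * j ^ 2 + 5) * (5 * j)) ≤ 7 * 2 ^ j := by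
  induction j, hj using Nat.le_induction with
  | base => norm_num
  | succ n hn ih =>
    rw [pow_succ 2 n]
    have h : (22 * (n + 1) ^ 2 + 5) * (5 * (n + 1)) ≤ 2 * ((22 * n ^ 2 + 5) * (5 * n)) := by
      nlinarith [mul_le_mul hn hn (by norm_num) (by omega), mul_le_mul_right hn (n ^ 2),
        mul_le_mul_right hn n]
    omega

theorem scale_mul_le_exp {j : ℕ} (hj : 30 ≤ j) : 67 * (scale j : ℝ) ≤ Real.exp (5 * j) := by
  have h1 : (128 : ℝ) ≤ Real.exp 5 := by
    rw [show (5 : ℝ) = ((5 : ℕ) : ℝ) * 1 by norm_num, Real.exp_nat_mul]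
    have h2 : (2.7 : ℝ) ≤ Real.exp 1 := by linarith [Real.exp_one_gt_d9]
    calc (128 : ℝ) ≤ 2.7 ^ 5 := by norm_num
      _ ≤ _ := by gcongr
  have h2 : Real.exp (5 * j) = Real.exp 5 ^ j := by rw [mul_comm, Real.exp_nat_mul]
  rw [h2]
  have h3 : (4 : ℝ) ^ 30 ≤ 4 ^ j := pow_le_pow_right₀ (by norm_num) hj
  calc 67 * (scale j : ℝ) = 67 * 1024 * 32 ^ j := by unfold scale; push_cast; ring
    _ ≤ 4 ^ j * 32 ^ j := by gcongr; exact le_trans (by norm_num) h3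
    _ = 128 ^ j := by rw [← mul_pow]; norm_num
    _ ≤ _ := by gcongr

theorem stagePot_zero_le {j : ℕ} (hj : 30 ≤ j) (A₀ : Finset ℕ) {K C : Finset ℕ}
    (P : ℕ → Finset ℕ) (hK : #K ≤ 32 * scale j) (hC : #C ≤ 32 * scale j) :
    stagePot j A₀ K C P 0 A₀ ≤ Real.exp (5 * j) := by
  refine le_trans ?_ (scale_mul_le_exp hj)
  have key : ∀ (I : Finset ℕ) (f : ℕ → ℝ), (∀ i ∈ I, f i ≤ 1) → ∑ i ∈ I, f i ≤ #I := by
    intro I f h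
    simpa using sum_le_card_nsmul I f 1 h
  unfold stagePot
  refine (add_le_add (add_le_add (add_le_add
    (key _ _ fun _ _ => pot_zero_le _ _ _ _ _) (key _ _ fun _ _ => pot_zero_le _ _ _ _ _))
    (key _ _ fun _ _ => pot_zero_le _ _ _ _ _)) (key _ _ fun _ _ => pot_zero_le _ _ _ _ _)).trans ?_
  rw [Nat.card_Icc, card_range]
  exact_mod_cast (by omega :
    scale j + 1 - 1 + 2 * scale j + #K + #C ≤ 67 * scale j)

theorem le_of_four_sums_le {I₁ I₂ I₃ I₄ : Finset ℕ} {f₁ f₂ f₃ f₄ : ℕ → ℝ} {L : ℝ}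
    (h₁ : ∀ i, 0 ≤ f₁ i) (h₂ : ∀ i, 0 ≤ f₂ i) (h₃ : ∀ i, 0 ≤ f₃ i) (h₄ : ∀ i, 0 ≤ f₄ i)
    (h : ∑ i ∈ I₁, f₁ i + ∑ i ∈ I₂, f₂ i + ∑ i ∈ I₃, f₃ i + ∑ i ∈ I₄, f₄ i ≤ L) :
    (∀ i ∈ I₁, f₁ i ≤ L) ∧ (∀ i ∈ I₂, f₂ i ≤ L) ∧ (∀ i ∈ I₃, f₃ i ≤ L) ∧
      ∀ i ∈ I₄, f₄ i ≤ L := by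
  have n1 := sum_nonneg fun i (_ : i ∈ I₁) => h₁ i
  have n2 := sum_nonneg fun i (_ : i ∈ I₂) => h₂ i
  have n3 := sum_nonneg fun i (_ : i ∈ I₃) => h₃ i
  have n4 := sum_nonneg fun i (_ : i ∈ I₄) => h₄ i
  refine ⟨fun i hi => ?_, fun i hi => ?_, fun i hi => ?_, fun i hi => ?_⟩
  · linarith [single_le_sum (fun i _ => h₁ i) hi]
  · linarith [single_le_sum (fun i _ => h₂ i) hi]
  · linarith [single_le_sum (fun i _ => h₃ i) hi]
  · linarith [single_le_sum (fun i _ => h₄ i) hi]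

theorem pots_le_of_stagePot_le {j : ℕ} {A₀ A K C : Finset ℕ} {P : ℕ → Finset ℕ} {t : ℕ} {L : ℝ}
    (h : stagePot j A₀ K C P t A ≤ L) :
    (∀ k ∈ Icc 1 (scale j),
      pot (fun A => diffs A k) (fun _ => True) 2 (8 * 4 ^ j / scale j) A₀ t A ≤ L) ∧
    (∀ k ∈ range (2 * scale j),
      pot (fun A => rho A k) (fun A => k ∉ A) (22 * j ^ 2 + 5)
        (64 * 16 ^ j / ((22 * j ^ 2 + 5) * scale j)) A₀ t A ≤ L) ∧
    (∀ i ∈ K, pot (fun A => forbCount A (P i)) (Disjoint (P i)) (10 * 8 ^ j)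
      (4 * #(P i) / scale j) A₀ t A ≤ L) ∧
    (∀ i ∈ C, pot (fun _ => 0) (Disjoint (P i)) 1 (-(#(P i) / (2 * scale j))) A₀ t A ≤ L) :=
  le_of_four_sums_le (fun _ => pot_nonneg _ _ _ _ _ _ _) (fun _ => pot_nonneg _ _ _ _ _ _ _)
    (fun _ => pot_nonneg _ _ _ _ _ _ _) (fun _ => pot_nonneg _ _ _ _ _ _ _) h

/-- What stage `j` needs to know about the set constructed before. -/
structure StageReady (j : ℕ) (A : Finset ℕ) : Prop where
  sub : A ⊆ Icc 1 (scale j)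
  good : Good A
  card_le : #A ≤ 4 ^ j
  bad_le : 2 * #(bad A) ≤ 8 ^ j
  diffs_le : ∀ k, 0 < k → diffs A k + 11 * j ≤ 11 * j ^ 2
  rho_le : ∀ k, k ∉ A → 2 * rho A k ≤ 2 ^ j

theorem diffs_eq_zero {N : ℕ} {A : Finset ℕ} (hA : A ⊆ Icc 1 N) {k : ℕ} (hk : N < k) :
    diffs A k = 0 := by
  rw [diffs, card_eq_zero, filter_eq_empty_iff]
  intro x _ h
  have := mem_Icc.1 (hA h)
  omega

theorem rho_eq_zero {N : ℕ} {A : Finset ℕ} (hA : A ⊆ Icc 1 N) {k : ℕ} (hk : 2 * N ≤ k) :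
    rho A k = 0 := by
  rw [rho, card_eq_zero, filter_eq_empty_iff]
  rintro ⟨x, y, z⟩ h h'
  simp only [mem_product] at h h'
  have h1 := mem_Icc.1 (hA h.1)
  have h2 := mem_Icc.1 (hA h.2.1)
  have h3 := mem_Icc.1 (hA h.2.2)
  omega

theorem four_pow_mul_eight_pow_le (j : ℕ) : 1024 * ((4 : ℝ) ^ j * 8 ^ j) = scale j := by
  rw [← mul_pow]; unfold scale; push_cast; norm_num

theorem controlled_of_stagePot_le {j : ℕ} (hj : 30 ≤ j) {A₀ A K C : Finset ℕ}
    {P : ℕ → Finset ℕ} {t : ℕ} (h₀ : StageReady j A₀) (hsub₀ : A₀ ⊆ A) (ht : t ≤ 4 ^ j)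
    (hsub : A ⊆ Icc 1 (scale j)) (hgood : Good A) (hcard : #A = #A₀ + t)
    (hbad : #(bad A) ≤ #(bad A₀) + t * (2 ^ j + 1))
    (hpot : stagePot j A₀ K C P t A ≤ Real.exp (5 * j)) :
    StageControlled j A := by
  obtain ⟨p1, p2, -, -⟩ := pots_le_of_stagePot_le hpot
  have hN : (0 : ℝ) < scale j := by exact_mod_cast scale_pos j
  have ht' : (t : ℝ) ≤ 4 ^ j := by exact_mod_cast ht
  have h8 : ((4 : ℝ) ^ j * 8 ^ j) = 32 ^ j := by rw [← mul_pow]; norm_num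
  have h16 : (4 : ℝ) ^ j * 16 ^ j = 64 ^ j := by rw [← mul_pow]; norm_num
  have h32 : (2 : ℝ) ^ j * 32 ^ j = 64 ^ j := by rw [← mul_pow]; norm_num
  refine ⟨hsub, hgood, ?_, ?_, ?_, ?_⟩
  · have := h₀.card_le; omega
  · have h1 := h₀.bad_le
    have h2 : t * (2 ^ j + 1) ≤ 4 ^ j * (2 ^ j + 1) := Nat.mul_le_mul_right _ ht
    have h3 : 4 ^ j * (2 ^ j + 1) = 8 ^ j + 4 ^ j := by
      rw [show (8 : ℕ) = 4 * 2 by norm_num, mul_pow]; ring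
    have h4 : 4 ^ j ≤ 8 ^ j := Nat.pow_le_pow_left (by norm_num) j
    omega
  · intro k hk
    by_cases hkN : scale j < k
    · rw [diffs_eq_zero hsub hkN]; exact Nat.zero_le _
    have h1 := le_of_pot_le (by norm_num) (p1 k (mem_Icc.2 ⟨hk, by omega⟩)) trivial
    have h2 : t * (8 * 4 ^ j / scale j : ℝ) ≤ 1 := by
      rw [mul_div_assoc', div_le_one hN, ← four_pow_mul_eight_pow_le]
      have : (4 : ℝ) ^ j ≤ 8 ^ j := by gcongr; norm_num
      calc t * (8 * 4 ^ j : ℝ) ≤ 4 ^ j * (8 * 8 ^ j) := by gcongr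
        _ ≤ _ := by nlinarith [pow_pos (show (0 : ℝ) < 4 by norm_num) j,
                      mul_pos (pow_pos (show (0 : ℝ) < 4 by norm_num) j)
                        (pow_pos (show (0 : ℝ) < 8 by norm_num) j)]
    have h3 : (diffs A k : ℝ) ≤ diffs A₀ k + (10 * j + 2) := by
      refine h1.trans ?_
      linarith
    have h4 : diffs A k ≤ diffs A₀ k + (10 * j + 2) := by exact_mod_cast h3
    have h5 := h₀.diffs_le k hk
    omega
  · intro k hk
    by_cases hkN : 2 * scale j ≤ k
    · rw [rho_eq_zero hsub hkN]; exact Nat.zero_le _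
    have hR : (0 : ℝ) < 22 * j ^ 2 + 5 := by positivity
    have h1 := le_of_pot_le hR (p2 k (mem_range.2 (by omega))) hk
    have h2 : (22 * j ^ 2 + 5) * (t * (64 * 16 ^ j / ((22 * j ^ 2 + 5) * scale j)) : ℝ) ≤
        2 ^ j / 16 := by
      have : (22 * j ^ 2 + 5) * (t * (64 * 16 ^ j / ((22 * j ^ 2 + 5) * scale j)) : ℝ) =
          64 * (t * 16 ^ j) / scale j := by field_simp
      rw [this, div_le_iff₀ hN, ← four_pow_mul_eight_pow_le, h8]
      have : t * (16 : ℝ) ^ j ≤ 4 ^ j * 16 ^ j := by gcongr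
      linarith
    have h3 : (16 * ((22 * j ^ 2 + 5) * (5 * j)) : ℝ) ≤ 7 * 2 ^ j := by
      exact_mod_cast cubic_le_two_pow hj
    have h4 : (2 * rho A₀ k : ℝ) ≤ 2 ^ j := by
      exact_mod_cast h₀.rho_le k fun h => hk (hsub₀ h)
    have h5 : (rho A k : ℝ) ≤ 2 ^ j := by
      rw [mul_add] at h1
      linarith
    exact_mod_cast h5

theorem forbCount_le_of_stagePot_le {j : ℕ} {A₀ A K C : Finset ℕ}
    {P : ℕ → Finset ℕ} {t : ℕ} (ht : t ≤ 4 ^ j)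
    (hpot : stagePot j A₀ K C P t A ≤ Real.exp (5 * j)) {i : ℕ} (hi : i ∈ K)
    (hP : 16384 * (j * 8 ^ j) ≤ #(P i)) (hd : Disjoint (P i) A) :
    4 * forbCount A (P i) ≤ 4 * forbCount A₀ (P i) + #(P i) := by
  obtain ⟨-, -, p3, -⟩ := pots_le_of_stagePot_le hpot
  have hN : (0 : ℝ) < scale j := by exact_mod_cast scale_pos j
  have ht' : (t : ℝ) ≤ 4 ^ j := by exact_mod_cast ht
  have h1 := le_of_pot_le (by positivity) (p3 i hi) hd
  have h2 : 10 * 8 ^ j * (t * (4 * #(P i) / scale j) : ℝ) ≤ 40 / 1024 * #(P i) := by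
    rw [mul_div_assoc', mul_div_assoc', div_le_iff₀ hN, ← four_pow_mul_eight_pow_le]
    calc 10 * 8 ^ j * (t * (4 * #(P i)) : ℝ) ≤ 10 * 8 ^ j * (4 ^ j * (4 * #(P i))) := by gcongr
      _ = _ := by ring
  have h3 : (16384 * (j * 8 ^ j) : ℝ) ≤ #(P i) := by exact_mod_cast hP
  have h4 : (4 * forbCount A (P i) : ℝ) ≤ 4 * forbCount A₀ (P i) + #(P i) := by
    rw [mul_add] at h1
    nlinarith
  exact_mod_cast h4

/-- One stage of the construction: `4 ^ j` elements of `[1, scale j]` are added so that all the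
sets `P i`, `i ∈ C`, are hit. -/
theorem exists_stage {j : ℕ} (hj : 30 ≤ j) {A₀ K C : Finset ℕ} {P : ℕ → Finset ℕ}
    (h₀ : StageReady j A₀) (hK : #K ≤ 32 * scale j) (hCK : C ⊆ K)
    (hP : ∀ i ∈ K, 16384 * (j * 8 ^ j) ≤ #(P i))
    (hCP : ∀ i ∈ C, P i ⊆ Icc 1 (scale j))
    (hCW : ∀ i ∈ C, Disjoint (P i) A₀ → 4 * forbCount A₀ (P i) ≤ #(P i)) :
    ∃ A, A₀ ⊆ A ∧ StageControlled j A ∧ #A = #A₀ + 4 ^ j ∧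
      (∀ i ∈ K, Disjoint (P i) A → 4 * forbCount A (P i) ≤ 4 * forbCount A₀ (P i) + #(P i)) ∧
      ∀ i ∈ C, ¬ Disjoint (P i) A := by
  have hind : ∀ t, t ≤ 4 ^ j → ∃ A, A₀ ⊆ A ∧ A ⊆ Icc 1 (scale j) ∧ Good A ∧ #A = #A₀ + t ∧
      #(bad A) ≤ #(bad A₀) + t * (2 ^ j + 1) ∧
      stagePot j A₀ K C P t A ≤ Real.exp (5 * j) := by
    intro t
    induction t with
    | zero =>
      intro _
      exact ⟨A₀, subset_rfl, h₀.sub, h₀.good, rfl, by simp,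
        stagePot_zero_le hj A₀ P hK ((card_le_card hCK).trans hK)⟩
    | succ t ih =>
      intro ht
      obtain ⟨A, hsub₀, hsub, hgood, hcard, hbad, hpot⟩ := ih (by omega)
      have hA := controlled_of_stagePot_le hj h₀ hsub₀ (by omega) hsub hgood hcard hbad hpot
      have hsum := sum_stagePot_le (A₀ := A₀) (K := K) (t := t) hA hCP (fun i hi hd => by
        have h1 := forbCount_le_of_stagePot_le (by omega) hpot (hCK hi) (hP i (hCK hi)) hd
        have h2 := hCW i hi (hd.mono_right hsub₀)
        omega)
      have hne : (free (scale j) A).Nonempty := by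
        rw [← card_pos]
        have := scale_le_two_mul_card_free hA
        have := scale_pos j
        omega
      rw [← nsmul_eq_mul, ← sum_const] at hsum
      obtain ⟨a, ha, hle⟩ := exists_le_of_sum_le hne hsum
      rw [free, mem_filter] at ha
      refine ⟨insert a A, hsub₀.trans (subset_insert a A), insert_subset ha.1 hsub,
        hgood.insert ha.2.2, ?_, ?_, hle.trans hpot⟩
      · rw [card_insert_of_notMem ha.2.1, hcard]; rfl
      · have h1 := card_bad_insert_le A a
        have h2 := hA.rho_le a ha.2.1
        rw [Nat.succ_mul]
        omega
  obtain ⟨A, hsub₀, hsub, hgood, hcard, hbad, hpot⟩ := hind _ le_rfl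
  refine ⟨A, hsub₀, controlled_of_stagePot_le hj h₀ hsub₀ le_rfl hsub hgood hcard hbad hpot,
    hcard, fun i hi => forbCount_le_of_stagePot_le le_rfl hpot hi (hP i hi), fun i hi hd => ?_⟩
  obtain ⟨-, -, -, p4⟩ := pots_le_of_stagePot_le hpot
  have h1 := le_of_pot_le one_pos (p4 i hi) hd
  have hN : (0 : ℝ) < scale j := by exact_mod_cast scale_pos j
  have h3 : (16384 * (j * 8 ^ j) : ℝ) ≤ #(P i) := by exact_mod_cast hP i (hCK hi)
  have h4 : (8 * j : ℝ) ≤ 4 ^ j * (#(P i) / (2 * scale j)) := by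
    rw [mul_div_assoc', le_div_iff₀ (by positivity), ← four_pow_mul_eight_pow_le]
    calc (8 * j * (2 * (1024 * (4 ^ j * 8 ^ j))) : ℝ) = 4 ^ j * (16384 * (j * 8 ^ j)) := by ring
      _ ≤ _ := by gcongr
  have h5 : (30 : ℝ) ≤ j := by exact_mod_cast hj
  push_cast at h1
  linarith

theorem StageControlled.ready {j : ℕ} {A : Finset ℕ} (h : StageControlled j A) :
    StageReady (j + 1) A := by
  refine ⟨h.sub.trans (Icc_subset_Icc_right ?_), h.good, ?_, ?_, fun k hk => ?_, fun k hk => ?_⟩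
  · rw [scale_succ]; omega
  · have := h.card_le
    rw [pow_succ]; omega
  · have := h.bad_le
    rw [pow_succ]; omega
  · have := h.diffs_le k hk
    nlinarith
  · have := h.rho_le k hk
    rw [pow_succ]; omega

theorem stageControlled_empty (j : ℕ) : StageControlled j ∅ :=
  ⟨empty_subset _, fun m => by simp [rep], by simp, by simp [bad], fun k _ => by simp [diffs],
    fun k _ => by simp [rho]⟩

theorem Forb.le {N f : ℕ} {A : Finset ℕ} (hA : A ⊆ Icc 1 N) (h : Forb A f) : f ≤ 2 * N := by
  obtain ⟨b, -, hb⟩ := h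
  obtain ⟨x, hx, y, hy, hxy⟩ := exists_of_rep_pos (show 0 < rep A (f + b) by omega)
  have h1 := mem_Icc.1 (hA hx)
  have h2 := mem_Icc.1 (hA hy)
  omega

/-- In stage `j` the small summand is taken from `[1, scale (smallIndex j)]`. -/
def smallIndex (j : ℕ) : ℕ := Nat.clog 4 (2 ^ 20 * (j * 2 ^ j))

/-- The sums of an element of `X` and a small element of `X`. -/
def sums (j : ℕ) (X : Finset ℕ) : Finset ℕ :=
  (X ×ˢ {z ∈ X | z ≤ scale (smallIndex j)}).image fun p => p.1 + p.2

/-- An element of `targets j X n` in the basis gives a representation of `n`. -/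
def targets (j : ℕ) (X : Finset ℕ) (n : ℕ) : Finset ℕ := (sums j X).image fun s => n - s

theorem le_of_mem_sums {j N s : ℕ} {X : Finset ℕ} (hX : X ⊆ Icc 1 N) (hs : s ∈ sums j X) :
    s ≤ 2 * N := by
  obtain ⟨⟨x, z⟩, hp, rfl⟩ := mem_image.1 hs
  simp only [mem_product, mem_filter] at hp
  have h1 := mem_Icc.1 (hX hp.1)
  have h2 := mem_Icc.1 (hX hp.2.1)
  omega

theorem card_targets {j N n : ℕ} {X : Finset ℕ} (hX : X ⊆ Icc 1 N) (hn : 2 * N ≤ n) :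
    #(targets j X n) = #(sums j X) := by
  refine card_image_of_injOn fun s hs t ht h => ?_
  have h1 := le_of_mem_sums hX hs
  have h2 := le_of_mem_sums hX ht
  omega

theorem targets_subset {j N n : ℕ} {X : Finset ℕ} (hX : X ⊆ Icc 1 N) (hn : 2 * N < n) :
    targets j X n ⊆ Icc 1 n := by
  intro f hf
  obtain ⟨s, hs, rfl⟩ := mem_image.1 hf
  have h1 := le_of_mem_sums hX hs
  rw [mem_Icc]
  omega

theorem forbCount_targets_eq_zero {j N n : ℕ} {X : Finset ℕ} (hX : X ⊆ Icc 1 N)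
    (hn : 4 * N < n) : forbCount X (targets j X n) = 0 := by
  rw [forbCount, card_eq_zero, filter_eq_empty_iff]
  intro f hf h
  obtain ⟨s, hs, rfl⟩ := mem_image.1 hf
  have h1 := le_of_mem_sums hX hs
  have h2 := h.le hX
  omega

/-- There are enough targets for the stage `j` to work. -/
def Big (j : ℕ) (X : Finset ℕ) (n : ℕ) : Prop := 16384 * (j * 8 ^ j) ≤ #(targets j X n)

/-- The invariant for two consecutive sets of the construction. -/
structure Linked (j : ℕ) (X Y : Finset ℕ) : Prop where
  sub : X ⊆ Icc 1 (scale j)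
  subset : X ⊆ Y
  controlled : StageControlled (j + 1) Y
  forb_le : ∀ n, scale (j + 1) < n → n ≤ scale (j + 2) → Big (j + 2) X n →
    Disjoint (targets (j + 2) X n) Y →
    4 * forbCount Y (targets (j + 2) X n) ≤ #(targets (j + 2) X n)

theorem linked_empty (j : ℕ) : Linked j ∅ ∅ :=
  ⟨empty_subset _, subset_rfl, stageControlled_empty _,
    fun n _ _ _ _ => by simp [targets, sums, forbCount]⟩

theorem Linked.exists_next {j : ℕ} (hj : 28 ≤ j) {X Y : Finset ℕ} (h : Linked j X Y) :
    ∃ Z, Linked (j + 1) Y Z ∧ #Z = #Y + 4 ^ (j + 2) ∧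
      ∀ n, scale (j + 1) < n → n ≤ scale (j + 2) → Big (j + 2) X n →
        ¬ Disjoint (targets (j + 2) X n) Z := by
  have s1 : scale (j + 1) = 32 * scale j := scale_succ j
  have s2 : scale (j + 2) = 32 * scale (j + 1) := scale_succ (j + 1)
  have s3 : scale (j + 3) = 32 * scale (j + 2) := scale_succ (j + 2)
  have s0 := scale_pos j
  set P : ℕ → Finset ℕ := fun n =>
    if n ≤ scale (j + 2) then targets (j + 2) X n else targets (j + 3) Y n
  have hP1 : ∀ {n}, n ≤ scale (j + 2) → P n = targets (j + 2) X n := fun hn => if_pos hn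
  have hP2 : ∀ {n}, scale (j + 2) < n → P n = targets (j + 3) Y n := fun hn => if_neg (by omega)
  set K : Finset ℕ := {n ∈ Ioc (scale (j + 1)) (scale (j + 3)) |
    16384 * ((j + 2) * 8 ^ (j + 2)) ≤ #(P n)}
  set C : Finset ℕ := {n ∈ K | n ≤ scale (j + 2)}
  have hCmem : ∀ {n}, n ∈ C → scale (j + 1) < n ∧ n ≤ scale (j + 2) ∧ Big (j + 2) X n := by
    intro n hn
    obtain ⟨hn1, hn2⟩ := mem_filter.1 hn
    obtain ⟨hn3, hn4⟩ := mem_filter.1 hn1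
    rw [hP1 hn2] at hn4
    exact ⟨(mem_Ioc.1 hn3).1, hn2, hn4⟩
  obtain ⟨Z, hYZ, hZ, hcard, hforb, hhit⟩ := exists_stage (j := j + 2) (by omega)
    (A₀ := Y) (K := K) (C := C) (P := P) h.controlled.ready
    ((card_filter_le _ _).trans (by rw [Nat.card_Ioc]; omega)) (filter_subset _ _)
    (fun i hi => (mem_filter.1 hi).2)
    (fun n hn => by
      obtain ⟨h1, h2, -⟩ := hCmem hn
      rw [hP1 h2]
      exact (targets_subset h.sub (by omega)).trans (Icc_subset_Icc_right h2))
    (fun n hn => by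
      obtain ⟨h1, h2, h3⟩ := hCmem hn
      rw [hP1 h2]
      exact h.forb_le n h1 h2 h3)
  refine ⟨Z, ⟨h.controlled.sub, hYZ, hZ, fun n h1 h2 h3 hd => ?_⟩, hcard, fun n h1 h2 h3 => ?_⟩
  · change scale (j + 2) < n at h1
    change n ≤ scale (j + 3) at h2
    have h4 : n ∈ K := by
      refine mem_filter.2 ⟨mem_Ioc.2 ⟨by omega, h2⟩, ?_⟩
      rw [hP2 h1]
      refine le_trans ?_ h3
      gcongr <;> omega
    have h5 := hforb n h4
    rw [hP2 h1, forbCount_targets_eq_zero h.controlled.sub (by omega)] at h5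
    simpa using h5 hd
  · have h4 : n ∈ C := by
      refine mem_filter.2 ⟨mem_filter.2 ⟨mem_Ioc.2 ⟨h1, by omega⟩, ?_⟩, h2⟩
      rw [hP1 h2]
      exact h3
    have h5 := hhit n h4
    rwa [hP1 h2] at h5

/-- The pairs of consecutive sets of the construction. -/
def stages : (k : ℕ) → {p : Finset ℕ × Finset ℕ // Linked (k + 28) p.1 p.2}
  | 0 => ⟨(∅, ∅), linked_empty _⟩
  | k + 1 => ⟨((stages k).1.2, ((stages k).2.exists_next (by omega)).choose),
      ((stages k).2.exists_next (by omega)).choose_spec.1⟩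

/-- The increasing sequence of sets whose union is the basis. -/
def layer (k : ℕ) : Finset ℕ := (stages k).1.1

theorem linked_layer (k : ℕ) : Linked (k + 28) (layer k) (layer (k + 1)) := (stages k).2

theorem layer_spec (k : ℕ) : #(layer (k + 2)) = #(layer (k + 1)) + 4 ^ (k + 30) ∧
    ∀ n, scale (k + 29) < n → n ≤ scale (k + 30) → Big (k + 30) (layer k) n →
      ¬ Disjoint (targets (k + 30) (layer k) n) (layer (k + 2)) :=
  ((stages k).2.exists_next (by omega)).choose_spec.2

theorem layer_mono : Monotone layer := monotone_nat_of_le_succ fun k => (linked_layer k).subset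

theorem good_layer (k : ℕ) : Good (layer k) := by
  cases k with
  | zero => exact (stageControlled_empty 0).good
  | succ k => exact (linked_layer k).controlled.good

theorem card_mul_card_le_sums {X : Finset ℕ} (hX : Good X) (j : ℕ) :
    #X * #{z ∈ X | z ≤ scale (smallIndex j)} ≤ 4 * #(sums j X) := by
  rw [← card_product]
  refine card_le_mul_card_image _ _ fun m _ => (card_le_card fun p hp => ?_).trans
    (hX.card_ordered_le m)
  simp only [mem_filter, mem_product] at hp ⊢
  tauto

theorem smallIndex_bounds {k : ℕ} (hk : 10 ≤ k) :
    30 ≤ smallIndex (k + 30) ∧ smallIndex (k + 30) ≤ k + 28 := by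
  have h2 : 2 ^ 40 ≤ 2 ^ (k + 30) := Nat.pow_le_pow_right (by norm_num) (by omega)
  constructor
  · refine Nat.succ_le_of_lt ((Nat.lt_clog_iff_pow_lt (by norm_num)).2 ?_)
    calc 4 ^ 29 < 2 ^ 20 * (1 * 2 ^ 40) := by norm_num
      _ ≤ _ := by gcongr; omega
  · refine (Nat.clog_le_iff_le_pow (by norm_num)).2 ?_
    have h3 : 2 ^ 24 * (k + 30) ≤ 2 ^ (k + 30) := by
      clear h2
      induction k, hk using Nat.le_induction with
      | base => norm_num
      | succ k hk ih => rw [show k + 1 + 30 = k + 30 + 1 by omega, pow_succ]; omega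
    have h4 : 4 ^ (k + 28) * 2 ^ 4 = 2 ^ (k + 30) * 2 ^ (k + 30) := by
      rw [show (4 : ℕ) = 2 ^ 2 by norm_num, ← pow_mul, ← pow_add, ← pow_add]; congr 1; omega
    nlinarith [Nat.mul_le_mul_right (2 ^ (k + 30)) h3]

theorem big_layer {k : ℕ} (hk : 10 ≤ k) {n : ℕ} (hn : scale (k + 29) < n) :
    Big (k + 30) (layer k) n := by
  obtain ⟨h1, h2⟩ := smallIndex_bounds hk
  have hcard : ∀ l, 4 ^ (l + 30) ≤ #(layer (l + 2)) := fun l => by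
    rw [(layer_spec l).1]; omega
  obtain ⟨l, hl⟩ := Nat.exists_eq_add_of_le' h1
  obtain ⟨m, rfl⟩ := Nat.exists_eq_add_of_le' (show 2 ≤ k by omega)
  have h3 := card_mul_card_le_sums (good_layer (m + 2)) (m + 2 + 30)
  have h4 : layer (l + 2) ⊆ {z ∈ layer (m + 2) | z ≤ scale (smallIndex (m + 2 + 30))} := by
    intro z hz
    refine mem_filter.2 ⟨layer_mono (by omega) hz, ?_⟩
    rw [hl]
    exact (mem_Icc.1 ((linked_layer (l + 2)).sub hz)).2
  have h5 := (hcard l).trans (card_le_card h4)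
  have h6 : 2 ^ 20 * ((m + 2 + 30) * 2 ^ (m + 2 + 30)) ≤ 4 ^ (l + 30) := by
    rw [← hl]; exact Nat.le_pow_clog (by norm_num) _
  have h7 := Nat.mul_le_mul (hcard m) (h6.trans h5)
  have s0 : scale (m + 2 + 29) = 32 * scale (m + 2 + 28) := scale_succ (m + 2 + 28)
  rw [Big, card_targets (linked_layer (m + 2)).sub (by omega)]
  have h8 : 4 ^ (m + 30) * (2 ^ 20 * ((m + 2 + 30) * 2 ^ (m + 2 + 30))) =
      4 * (16384 * ((m + 2 + 30) * 8 ^ (m + 2 + 30))) := by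
    rw [show (8 : ℕ) = 4 * 2 by norm_num, mul_pow, show m + 2 + 30 = m + 30 + 2 by omega,
      pow_add 4 (m + 30)]
    ring
  omega

theorem scale_smallIndex_sq_le {j n : ℕ} (hj : 0 < j) (hn : scale j < 32 * n) :
    (scale (smallIndex j) : ℝ) ^ 2 ≤ 2 ^ 126 * n * Real.log n ^ 5 := by
  have h1 : 4 ^ smallIndex j ≤ 4 * (2 ^ 20 * (j * 2 ^ j)) := by
    have h2 : 1 < 2 ^ 20 * (j * 2 ^ j) := by
      have := Nat.one_le_two_pow (n := j)
      nlinarith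
    have h3 := Nat.pow_pred_clog_lt_self (b := 4) (by norm_num) h2
    have h4 : 0 < smallIndex j := Nat.clog_pos (by norm_num) h2
    obtain ⟨i, hi⟩ := Nat.exists_eq_succ_of_ne_zero h4.ne'
    rw [smallIndex] at hi ⊢
    rw [hi] at h3 ⊢
    rw [pow_succ]
    simp only [Nat.pred_succ] at h3
    omega
  have h2 : scale (smallIndex j) ^ 2 ≤ 2 ^ 130 * j ^ 5 * 32 ^ j := by
    calc scale (smallIndex j) ^ 2 = 2 ^ 20 * (4 ^ smallIndex j) ^ 5 := by
          rw [scale, mul_pow, ← pow_mul, ← pow_mul, mul_comm _ 2, mul_comm _ 5, pow_mul, pow_mul]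
          norm_num
      _ ≤ 2 ^ 20 * (4 * (2 ^ 20 * (j * 2 ^ j))) ^ 5 := by gcongr
      _ = 2 ^ 130 * j ^ 5 * (2 ^ j) ^ 5 := by ring
      _ = _ := by rw [← pow_mul, mul_comm _ 5, pow_mul]; norm_num
  have h3 : 32 * 32 ^ j ≤ n := by
    rw [scale] at hn
    omega
  have h4 : (j : ℝ) ≤ Real.log n := by
    have hn0 : (0 : ℝ) < n := by
      have := pow_pos (show 0 < 32 by norm_num) j
      exact_mod_cast (by omega : 0 < n)
    rw [Real.le_log_iff_exp_le hn0, ← mul_one (j : ℝ), Real.exp_nat_mul]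
    calc Real.exp 1 ^ j ≤ 32 ^ j := by
          gcongr
          linarith [Real.exp_one_lt_d9]
      _ ≤ n := by exact_mod_cast (by omega : 32 ^ j ≤ n)
  have h6 : (32 * 32 ^ j : ℝ) ≤ n := by exact_mod_cast h3
  calc (scale (smallIndex j) : ℝ) ^ 2 ≤ 2 ^ 130 * (j : ℝ) ^ 5 * 32 ^ j := by exact_mod_cast h2
    _ = 2 ^ 125 * (j : ℝ) ^ 5 * (32 * 32 ^ j) := by ring
    _ ≤ 2 ^ 126 * Real.log n ^ 5 * n := by gcongr <;> norm_num
    _ = _ := by ring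

theorem le_of_sq_le_mul_log {z n c : ℝ} (hn : 1 ≤ n) (hc : 0 ≤ c)
    (h : z ^ 2 ≤ c ^ 2 * n * Real.log n ^ 5) :
    z ≤ c * n ^ ((1 : ℝ) / 2) * Real.log n ^ ((5 : ℝ) / 2) := by
  have hl := Real.log_nonneg hn
  have hn0 : 0 ≤ n := by linarith
  refine le_of_sq_le_sq (h.trans (le_of_eq ?_)) (by positivity)
  rw [mul_pow, mul_pow, ← Real.rpow_mul_natCast hn0, ← Real.rpow_mul_natCast hl,
    show (1 : ℝ) / 2 * (2 : ℕ) = 1 by norm_num, show (5 : ℝ) / 2 * (2 : ℕ) = (5 : ℕ) by norm_num,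
    Real.rpow_one, Real.rpow_natCast]

theorem exists_scale_lt_le {n : ℕ} (hn : scale 40 ≤ n) :
    ∃ k, 10 ≤ k ∧ scale (k + 29) < n ∧ n ≤ scale (k + 30) := by
  have hex : ∃ k, n ≤ scale (k + 30) := by
    refine ⟨n, ?_⟩
    have h1 : n < 32 ^ n := Nat.lt_pow_self (by norm_num)
    rw [scale, pow_add]
    nlinarith
  have hmono : StrictMono scale := strictMono_nat_of_lt_succ fun j => by
    have := scale_pos j
    rw [scale_succ]
    omega
  have hspec := Nat.find_spec hex
  have h10 : 10 ≤ Nat.find hex := by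
    by_contra! h
    have := hmono (show Nat.find hex + 30 < 40 by omega)
    omega
  refine ⟨Nat.find hex, h10, ?_, hspec⟩
  have := Nat.find_min hex (show Nat.find hex - 1 < Nat.find hex by omega)
  rw [show Nat.find hex - 1 + 30 = Nat.find hex + 29 by omega] at this
  omega

/-- A `B₂[2]` sequence which is a basis of order three. -/
def basis : Set ℕ := ⋃ k, (layer k : Set ℕ)

theorem isB2g_basis : IsB2g basis 2 := by
  intro m
  have hdir : Directed (· ⊆ ·) fun k => (layer k : Set ℕ) :=
    Monotone.directed_le fun a b h => coe_subset.2 (layer_mono h)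
  obtain ⟨k, hk⟩ := hdir.exists_mem_subset_of_finset_subset_biUnion
    (s := {x ∈ range (m + 1) | x ∈ basis}) (fun x hx => (mem_filter.1 hx).2)
  have hmem : ∀ x ∈ basis, x ≤ m → x ∈ layer k := fun x hx hxm =>
    hk (mem_filter.2 ⟨mem_range.2 (by omega), hx⟩)
  refine le_trans ?_ (good_layer k m)
  rw [rA, rep, ← Set.ncard_coe_finset]
  refine Set.ncard_le_ncard ?_ (finite_toSet _)
  rintro ⟨x, y⟩ ⟨hx, hy, hxy, rfl⟩
  dsimp only at hx hy hxy hmem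
  simp only [coe_filter, mem_product, Set.mem_ofPred_eq]
  exact ⟨⟨hmem x hx (by omega), hmem y hy (by omega)⟩, hxy, trivial⟩

theorem exists_basis_repr {n : ℕ} (hn : scale 40 ≤ n) :
    ∃ a₁ ∈ basis, ∃ a₂ ∈ basis, ∃ a₃ ∈ basis, n = a₁ + a₂ + a₃ ∧
      (a₃ : ℝ) ≤ 2 ^ 63 * (n : ℝ) ^ ((1 : ℝ) / 2) * Real.log n ^ ((5 : ℝ) / 2) := by
  obtain ⟨k, hk, h1, h2⟩ := exists_scale_lt_le hn
  obtain ⟨f, hf, hfA⟩ := not_disjoint_iff.1 ((layer_spec k).2 n h1 h2 (big_layer hk h1))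
  obtain ⟨s, hs, rfl⟩ := mem_image.1 hf
  have h3 := le_of_mem_sums (linked_layer k).sub hs
  have s0 : scale (k + 29) = 32 * scale (k + 28) := scale_succ (k + 28)
  obtain ⟨⟨x, z⟩, hp, rfl⟩ := mem_image.1 hs
  simp only [mem_product, mem_filter] at hp
  dsimp only at *
  have hmem : ∀ {k x}, x ∈ layer k → x ∈ basis := fun hx => Set.mem_iUnion.2 ⟨_, hx⟩
  refine ⟨_, hmem hfA, x, hmem hp.1, z, hmem hp.2.1, by omega, ?_⟩
  have hz : (z : ℝ) ≤ scale (smallIndex (k + 30)) := by exact_mod_cast hp.2.2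
  have s1 : scale (k + 30) = 32 * scale (k + 29) := scale_succ (k + 29)
  refine hz.trans (le_of_sq_le_mul_log (by exact_mod_cast (by omega : 1 ≤ n)) (by norm_num) ?_)
  rw [show ((2 : ℝ) ^ 63) ^ 2 = 2 ^ 126 by norm_num]
  exact scale_smallIndex_sq_le (by omega) (by omega)

end AdditiveBasis

theorem stmt3 :
    ∃ (A : Set ℕ) (C : ℝ) (N₀ : ℕ), 0 < C ∧ IsB2g A 2 ∧
      ∀ n : ℕ, N₀ ≤ n → ∃ a₁ ∈ A, ∃ a₂ ∈ A, ∃ a₃ ∈ A,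
        n = a₁ + a₂ + a₃ ∧
        (a₃ : ℝ) ≤ C * (n : ℝ) ^ ((1 : ℝ) / 2) * Real.log n ^ ((5 : ℝ) / 2) :=
  ⟨AdditiveBasis.basis, 2 ^ 63, AdditiveBasis.scale 40, by norm_num, AdditiveBasis.isB2g_basis,
    fun _ hn => AdditiveBasis.exists_basis_repr hn⟩
end
end

section
/- There exist infinitely many positive integers M with the following property: the cyclic group ℤ/Mℤ contains a Sidon set S such that every n ∈ ℤ/Mℤ can be written as n = s₁ + s₂ + s₃ with s₁, s₂, s₃ ∈ S pairwise distinct. -/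
noncomputable section

/-- `S ⊆ ℤ/Mℤ` is a Sidon set. -/
def IsSidonZ {M : ℕ} (S : Set (ZMod M)) : Prop :=
  ∀ a ∈ S, ∀ b ∈ S, ∀ c ∈ S, ∀ d ∈ S, a + b = c + d → ({a, b} : Set (ZMod M)) = {c, d}

open Polynomial in
/-- A polynomial over a finite field with `q` elements that vanishes everywhere is divisible by
`X ^ q - X`. -/
theorem X_pow_card_sub_X_dvd_of_forall_eval_eq_zero {K : Type*} [Field K] [Fintype K] {P : K[X]}
    (h : ∀ t, P.eval t = 0) : (X ^ Fintype.card K - X : K[X]) ∣ P := by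
  have hq : 1 < Fintype.card K := Fintype.one_lt_card
  have hmonic : (X ^ Fintype.card K - X : K[X]).Monic :=
    monic_X_pow_sub (by rw [degree_X]; exact_mod_cast hq)
  rw [← modByMonic_eq_zero_iff_dvd hmonic]
  refine eq_zero_of_natDegree_lt_card_of_eval_eq_zero' _ Finset.univ (fun t _ => ?_) ?_
  · rw [modByMonic_eq_sub_mul_div]
    simp [h, FiniteField.pow_card]
  · have hdeg := FiniteField.X_pow_card_sub_X_natDegree_eq K hq
    refine (natDegree_modByMonic_lt P hmonic fun h1 => ?_).trans_eq hdeg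
    rw [h1, natDegree_one] at hdeg
    omega

open Polynomial in
/-- A weak lower bound for the number of square values of a cubic modulo `p`, by Stepanov's
method: the places where its value is a square are not all zeros of a polynomial `g` of small
degree. -/
theorem exists_isSquare_eval_cubic {p : ℕ} [Fact p.Prime] {f g : (ZMod p)[X]}
    (hf : f.natDegree = 3) (hg : g ≠ 0) (hp : 4 * g.natDegree + 3 < p) :
    ∃ t, g.eval t ≠ 0 ∧ IsSquare (f.eval t) := by
  by_contra! hcon
  obtain ⟨m, hm⟩ : ∃ m, p = 2 * m + 1 := (Fact.out : p.Prime).odd_of_ne_two (by omega)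
  have hf0 : f ≠ 0 := by rintro rfl; simp at hf
  have hu : (f ^ m + 1).natDegree = 3 * m := by
    rw [← C_1, natDegree_add_C, natDegree_pow, hf, mul_comm]
  have hu0 : f ^ m + 1 ≠ 0 := by intro h; rw [h, natDegree_zero] at hu; omega
  have hX : (X ^ p - X : (ZMod p)[X]).natDegree = p :=
    FiniteField.X_pow_card_sub_X_natDegree_eq _ (by omega)
  have hX0 : (X ^ p - X : (ZMod p)[X]) ≠ 0 := FiniteField.X_pow_card_sub_X_ne_zero _ (by omega)
  obtain ⟨h, hh⟩ : (X ^ p - X : (ZMod p)[X]) ∣ g * (f ^ m + 1) := by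
    suffices hdvd : (X ^ Fintype.card (ZMod p) - X : (ZMod p)[X]) ∣ g * (f ^ m + 1) by
      simpa only [ZMod.card] using hdvd
    refine X_pow_card_sub_X_dvd_of_forall_eval_eq_zero fun t => ?_
    by_cases ht : g.eval t = 0
    · simp [ht]
    have hns := hcon t ht
    have h0 : f.eval t ≠ 0 := fun h0 => hns (h0 ▸ IsSquare.zero)
    have hpm : p / 2 = m := by omega
    have := ZMod.euler_criterion p h0
    have hneg := (ZMod.pow_div_two_eq_neg_one_or_one p h0).resolve_left (by tauto)
    rw [hpm] at hneg
    simp [hneg]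
  have hh0 : h ≠ 0 := by
    rintro rfl
    exact mul_ne_zero hg hu0 (by simpa using hh)
  have hdeg : g.natDegree + 3 * m = p + h.natDegree := by
    rw [← hu, ← natDegree_mul hg hu0, hh, natDegree_mul hX0 hh0, hX]
  have hder : 2 * f * derivative (f ^ m) = -(derivative f * f ^ m) := by
    obtain ⟨k, rfl⟩ : ∃ k, m = k + 1 := ⟨m - 1, by omega⟩
    have hchar : (2 * ((k + 1 : ℕ) : (ZMod p)[X]) + 1) = 0 := by
      have : ((2 * (k + 1) + 1 : ℕ) : (ZMod p)[X]) = 0 := by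
        rw [← hm]; exact CharP.cast_eq_zero _ p
      exact_mod_cast this
    rw [derivative_pow_succ]
    push_cast at hchar ⊢
    simp only [map_add, map_natCast, map_one]
    linear_combination (derivative f * f ^ (k + 1)) * hchar
  have hdX : derivative (X ^ p - X : (ZMod p)[X]) = -1 := by
    simp [derivative_X_pow]
  have hD := congrArg derivative hh
  rw [derivative_mul, derivative_mul, hdX, derivative_add, derivative_one, add_zero] at hD
  have hdvd : (X ^ p - X : (ZMod p)[X]) ∣ g * (2 * f * h + g * derivative f) := by
    refine ⟨2 * f * g * derivative h + g * derivative f * h - 2 * f * derivative g * h, ?_⟩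
    linear_combination (g * derivative f - 2 * f * derivative g) * hh
      + 2 * f * g * hD - g ^ 2 * hder
  have h2f : (2 * f * h).natDegree = 3 + h.natDegree := by
    have h2 : (2 : ZMod p) ≠ 0 := Ring.two_ne_zero (by rw [ZMod.ringChar_zmod_n]; omega)
    rw [mul_assoc, ← C_ofNat, natDegree_C_mul h2, natDegree_mul hf0 hh0, hf]
  have hgf : (g * derivative f).natDegree ≤ g.natDegree + 2 := by
    refine natDegree_mul_le.trans ?_
    have := natDegree_derivative_le f
    omega
  have hsum : (2 * f * h + g * derivative f).natDegree = 3 + h.natDegree := by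
    rw [natDegree_add_eq_left_of_natDegree_lt (by omega), h2f]
  have hsum0 : 2 * f * h + g * derivative f ≠ 0 := by
    intro h; rw [h, natDegree_zero] at hsum; omega
  have := natDegree_le_of_dvd hdvd (mul_ne_zero hg hsum0)
  rw [hX, natDegree_mul hg hsum0, hsum] at this
  omega

open Polynomial in
/-- Modulo a prime `p > 31`, three distinct residues can have any given sum and any given
nonzero product. -/
theorem exists_distinct_sum_prod {p : ℕ} [Fact p.Prime] (hp : 31 < p) (A B : ZMod p)
    (hA : A ≠ 0) : ∃ x y z : ZMod p, x ≠ y ∧ x ≠ z ∧ y ≠ z ∧ x + y + z = B ∧ x * y * z = A := by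
  have h2 : (2 : ZMod p) ≠ 0 := Ring.two_ne_zero (by rw [ZMod.ringChar_zmod_n]; omega)
  have h4 : -4 * A ≠ 0 := by
    have : (-4 : ZMod p) = -(2 * 2) := by norm_num
    rw [this]
    exact mul_ne_zero (neg_ne_zero.mpr (mul_ne_zero h2 h2)) hA
  let f : (ZMod p)[X] := C (-4 * A) * X ^ 3 + C (B ^ 2) * X ^ 2 + C (-2 * B) * X + C 1
  let k : (ZMod p)[X] := C A * X ^ 3 + C 0 * X ^ 2 + C (-B) * X + C 2
  have hf : f.natDegree = 3 := natDegree_cubic h4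
  have hk : k.natDegree = 3 := natDegree_cubic hA
  have hf0 : f ≠ 0 := by intro h; simp [h] at hf
  have hk0 : k ≠ 0 := by intro h; simp [h] at hk
  have hg : (X * f * k).natDegree = 7 := by
    rw [natDegree_mul (mul_ne_zero X_ne_zero hf0) hk0, natDegree_mul X_ne_zero hf0, hf, hk,
      natDegree_X]
  obtain ⟨t, ht, r, hr⟩ := exists_isSquare_eval_cubic hf
    (mul_ne_zero (mul_ne_zero X_ne_zero hf0) hk0) (by omega)
  rw [eval_mul, eval_mul, eval_X] at ht
  have ht0 : t ≠ 0 := fun h => ht (by simp [h])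
  have hft : f.eval t ≠ 0 := fun h => ht (by simp [h])
  have hkt : k.eval t ≠ 0 := fun h => ht (by simp [h])
  have hr0 : r ≠ 0 := by rintro rfl; simp [hr] at hft
  simp only [f, k, eval_add, eval_mul, eval_C, eval_pow, eval_X] at hr hkt
  have key : ∀ s : ZMod p, s * s = r * r → t⁻¹ ≠ (B * t - 1 + s) / (2 * t) := by
    intro s hs h
    field_simp at h
    apply hkt
    have hz : s = 3 - B * t := by linear_combination -h
    rw [hz] at hs
    have : 4 * (A * t ^ 3 + 0 * t ^ 2 + -B * t + 2) = 0 := by linear_combination hs - hr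
    rcases mul_eq_zero.mp this with h4' | h
    · exact absurd (by rw [neg_mul, h4', zero_mul, neg_zero]) h4
    · exact h
  refine ⟨t⁻¹, (B * t - 1 + r) / (2 * t), (B * t - 1 + -r) / (2 * t), key r rfl,
    key (-r) (by ring), ?_, ?_, ?_⟩
  · intro h
    field_simp at h
    have : 2 * r = 0 := by linear_combination h
    exact mul_ne_zero h2 hr0 this
  · field_simp
    ring
  · field_simp
    linear_combination hr

/-- Two elements of an integral domain are determined, up to order, by their sum and product. -/
theorem eq_and_eq_or_of_add_eq_of_mul_eq {R : Type*} [CommRing R] [IsDomain R] {a b c d : R}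
    (hs : a + b = c + d) (hm : a * b = c * d) : a = c ∧ b = d ∨ a = d ∧ b = c := by
  have h : (a - c) * (a - d) = 0 := by linear_combination a * hs - hm
  rcases mul_eq_zero.mp h with h | h
  · exact .inl ⟨by linear_combination h, by linear_combination hs - h⟩
  · exact .inr ⟨by linear_combination h, by linear_combination hs - h⟩

/-- `ℤ/p(p-1)ℤ` is the product of the additive and the multiplicative group of `ℤ/pℤ`. -/
def zmodAddEquivProdUnits (p : ℕ) [Fact p.Prime] :
    ZMod (p * (p - 1)) ≃+ ZMod p × Additive (ZMod p)ˣ :=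
  have hcop : p.Coprime (p - 1) :=
    ((Nat.coprime_self_sub_right (Fact.out : p.Prime).one_le).mpr (Nat.coprime_one_right p))
  have hcard : Nat.card (Additive (ZMod p)ˣ) = p - 1 := by
    rw [Nat.card_congr Additive.toMul, Nat.card_eq_fintype_card, ZMod.card_units]
  (ZMod.chineseRemainder hcop).toAddEquiv.trans
    ((AddEquiv.refl _).prodCongr
      ((ZMod.ringEquivCongr hcard.symm).toAddEquiv.trans
        (zmodAddCyclicAddEquiv inferInstance)))

theorem stmt5 :
    {M : ℕ | 0 < M ∧ ∃ S : Set (ZMod M), IsSidonZ S ∧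
      ∀ n : ZMod M, ∃ s₁ ∈ S, ∃ s₂ ∈ S, ∃ s₃ ∈ S,
        s₁ ≠ s₂ ∧ s₁ ≠ s₃ ∧ s₂ ≠ s₃ ∧ n = s₁ + s₂ + s₃}.Infinite := by
  refine Set.infinite_of_forall_exists_gt fun n => ?_
  obtain ⟨p, hpn, hp⟩ := Nat.exists_infinite_primes (n + 32)
  have : Fact p.Prime := ⟨hp⟩
  have hle : p ≤ p * (p - 1) := Nat.le_mul_of_pos_right p (by omega)
  let φ := zmodAddEquivProdUnits p
  refine ⟨p * (p - 1), ⟨by omega, {s | ((φ s).2.toMul : ZMod p) = (φ s).1}, ?_, ?_⟩, by omega⟩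
  · intro a ha b hb c hc d hd h
    have hinj : ∀ s ∈ {s | ((φ s).2.toMul : ZMod p) = (φ s).1},
        ∀ s' ∈ {s | ((φ s).2.toMul : ZMod p) = (φ s).1}, (φ s).1 = (φ s').1 → s = s' := by
      intro s hs s' hs' h
      refine φ.injective (Prod.ext h (Additive.toMul.injective (Units.ext ?_)))
      exact hs.trans (h.trans hs'.symm)
    have hφ := congrArg φ h
    rw [map_add, map_add] at hφ
    have hs : (φ a).1 + (φ b).1 = (φ c).1 + (φ d).1 := congrArg Prod.fst hφ
    have hm : (φ a).1 * (φ b).1 = (φ c).1 * (φ d).1 := by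
      rw [← ha, ← hb, ← hc, ← hd]
      exact congrArg (fun x => (x.2.toMul : ZMod p)) hφ
    rcases eq_and_eq_or_of_add_eq_of_mul_eq hs hm with ⟨h₁, h₂⟩ | ⟨h₁, h₂⟩
    · rw [hinj a ha c hc h₁, hinj b hb d hd h₂]
    · rw [hinj a ha d hd h₁, hinj b hb c hc h₂, Set.pair_comm]
  · intro n
    obtain ⟨x, y, z, hxy, hxz, hyz, hs, hm⟩ := exists_distinct_sum_prod (by omega)
      ((φ n).2.toMul : ZMod p) (φ n).1 (Units.ne_zero _)
    have hxyz : x * y * z ≠ 0 := hm ▸ Units.ne_zero _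
    have hx : x ≠ 0 := by rintro rfl; simp at hxyz
    have hy : y ≠ 0 := by rintro rfl; simp at hxyz
    have hz : z ≠ 0 := by rintro rfl; simp at hxyz
    let ψ (w : ZMod p) (hw : w ≠ 0) := φ.symm (w, .ofMul (Units.mk0 w hw))
    have hψ (w : ZMod p) (hw : w ≠ 0) : φ (ψ w hw) = (w, .ofMul (Units.mk0 w hw)) :=
      φ.apply_symm_apply _
    have hne (v w : ZMod p) (hv : v ≠ 0) (hw : w ≠ 0) (hvw : v ≠ w) : ψ v hv ≠ ψ w hw := by
      intro h
      have := congrArg φ h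
      rw [hψ, hψ] at this
      exact hvw (congrArg Prod.fst this)
    refine ⟨ψ x hx, by simp [hψ], ψ y hy, by simp [hψ], ψ z hz, by simp [hψ],
      hne _ _ _ _ hxy, hne _ _ _ _ hxz, hne _ _ _ _ hyz, φ.injective ?_⟩
    rw [map_add, map_add, hψ, hψ, hψ]
    refine Prod.ext hs.symm (Additive.toMul.injective (Units.ext ?_))
    simpa using hm.symm
end
end
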